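/- arXiv:2205.13413 — 4 statements merged into one kernel-verified Lean document; each statement's English description precedes it below -/
import Mathlib

section
/- Let 0 < α < 2, let β be an arbitrary real number, and let μ be such that πα/2 < μ < min{π, πα}. Then there exists a constant C > 0 such that for every z ∈ ℂ with μ ≤ |arg(z)| ≤ π, one has |E_{α,β}(z)| ≤ C / (1 + |z|). -/
open MeasureTheory Set Complex

/-- The two-parametric Mittag-Leffler function `E_{α,β}(z) = ∑ z^k / Γ(αk + β)`. -/
noncomputable def mittagLeffler (α β : ℝ) (z : ℂ) : ℂ :=
  ∑' k : ℕ, z ^ k / Complex.Gamma (((α * k + β : ℝ) : ℂ))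


open Filter Topology

/-- The integrand `e^t t^{-s} dt` of Hankel's integral for `1 / Γ(s)`, in the coordinate `t = e^w`. -/
noncomputable def hankelKernel (s : ℝ) (w : ℂ) : ℂ :=
  Complex.exp (Complex.exp w + (1 - s) * w)

/-- The integral of `f` along the contour which comes in from `+∞ - θi` to `ρ - θi`, goes up to
`ρ + θi`, and leaves to `+∞ + θi`. -/
noncomputable def hankelIntegral (θ ρ : ℝ) (f : ℂ → ℂ) : ℂ :=
  (∫ x in Ioi ρ, f (x + θ * I)) - (∫ x in Ioi ρ, f (x + (-θ : ℝ) * I)) +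
    I * ∫ y in (-θ)..θ, f (ρ + y * I)

lemma differentiable_hankelKernel (s : ℝ) : Differentiable ℂ (hankelKernel s) := by
  unfold hankelKernel; fun_prop

lemma continuous_hankelKernel (s : ℝ) : Continuous (hankelKernel s) :=
  (differentiable_hankelKernel s).continuous

lemma norm_hankelKernel (s x y : ℝ) :
    ‖hankelKernel s (x + y * I)‖ = Real.exp (Real.cos y * Real.exp x + (1 - s) * x) := by
  rw [hankelKernel, Complex.norm_exp]
  congr 1
  rw [Complex.add_re, Complex.exp_re, ← Complex.ofReal_one, ← Complex.ofReal_sub,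
    Complex.re_ofReal_mul]
  simp
  ring

lemma norm_hankelKernel_le {a s x y : ℝ} (hy : Real.cos y ≤ -a) :
    ‖hankelKernel s (x + y * I)‖ ≤ Real.exp (-a * Real.exp x + (1 - s) * x) := by
  rw [norm_hankelKernel]
  gcongr

lemma exp_neg_mul_exp_le {a : ℝ} (ha : 0 < a) (c : ℝ) {x : ℝ} (hx : 0 ≤ x) :
    Real.exp (-a * Real.exp x + c * x) ≤ Real.exp ((c + 1) ^ 2 / (2 * a)) * Real.exp (-x) := by
  rw [← Real.exp_add]
  apply Real.exp_le_exp.2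
  have h1 := Real.quadratic_le_exp_of_nonneg hx
  have h2 : a * (x ^ 2 / 2) ≤ a * Real.exp x := by gcongr; linarith
  have h3 : (c + 1) ^ 2 / (2 * a) - (c + 1) * x + a * (x ^ 2 / 2)
      = (c + 1 - a * x) ^ 2 / (2 * a) := by
    field_simp
    ring
  have h4 : 0 ≤ (c + 1 - a * x) ^ 2 / (2 * a) := by positivity
  linarith

lemma integrableOn_exp_neg_mul_exp {a : ℝ} (ha : 0 < a) (c ρ : ℝ) :
    IntegrableOn (fun x : ℝ => Real.exp (-a * Real.exp x + c * x)) (Ioi ρ) := by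
  have hc : Continuous fun x : ℝ => Real.exp (-a * Real.exp x + c * x) := by fun_prop
  have h0 : IntegrableOn (fun x : ℝ => Real.exp (-a * Real.exp x + c * x)) (Ioi (max ρ 0)) := by
    refine Integrable.mono'
      ((integrableOn_exp_neg_Ioi (max ρ 0)).const_mul (Real.exp ((c + 1) ^ 2 / (2 * a))))
      hc.aestronglyMeasurable ?_
    filter_upwards [ae_restrict_mem measurableSet_Ioi] with x hx
    rw [Real.norm_of_nonneg (Real.exp_pos _).le]
    exact exp_neg_mul_exp_le ha c ((le_max_right ρ 0).trans (le_of_lt hx))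
  rw [← Ioc_union_Ioi_eq_Ioi (le_max_left ρ 0)]
  exact (hc.integrableOn_Ioc).union h0

lemma integrable_exp_neg_mul_exp {a : ℝ} (ha : 0 < a) {c : ℝ} (hc : 0 < c) :
    Integrable (fun x : ℝ => Real.exp (-a * Real.exp x + c * x)) := by
  rw [← integrableOn_univ, ← Iic_union_Ioi (a := (0 : ℝ))]
  refine IntegrableOn.union ?_ (integrableOn_exp_neg_mul_exp ha c 0)
  refine Integrable.mono' (integrableOn_exp_mul_Iic hc 0)
    (by fun_prop) (ae_of_all _ fun x => ?_)
  rw [Real.norm_of_nonneg (Real.exp_pos _).le]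
  apply Real.exp_le_exp.2
  have := mul_pos ha (Real.exp_pos x)
  linarith

lemma tendsto_exp_neg_mul_exp_atTop {a : ℝ} (ha : 0 < a) (c : ℝ) :
    Tendsto (fun x : ℝ => Real.exp (-a * Real.exp x + c * x)) atTop (𝓝 0) := by
  refine squeeze_zero' (Eventually.of_forall fun x => (Real.exp_pos _).le)
    ((eventually_ge_atTop 0).mono fun x hx => exp_neg_mul_exp_le ha c hx) ?_
  simpa using (Real.tendsto_exp_neg_atTop_nhds_zero).const_mul (Real.exp ((c + 1) ^ 2 / (2 * a)))

lemma tendsto_exp_mul_exp_atBot (a : ℝ) {c : ℝ} (hc : 0 < c) :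
    Tendsto (fun x : ℝ => Real.exp (a * Real.exp x + c * x)) atBot (𝓝 0) := by
  refine Real.tendsto_exp_atBot.comp ?_
  refine Tendsto.add_atBot (C := a * 0) ?_ ?_
  · exact Real.tendsto_exp_atBot.const_mul a
  · exact tendsto_id.const_mul_atBot hc

lemma integrableOn_hankelKernel {a : ℝ} (ha : 0 < a) (s ρ : ℝ) {y : ℝ} (hy : Real.cos y ≤ -a) :
    IntegrableOn (fun x : ℝ => hankelKernel s (x + y * I)) (Ioi ρ) :=
  Integrable.mono' (integrableOn_exp_neg_mul_exp ha (1 - s) ρ)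
    ((continuous_hankelKernel s).comp (by fun_prop)).aestronglyMeasurable
    (ae_of_all _ fun _ => norm_hankelKernel_le hy)

lemma integrable_hankelKernel {a : ℝ} (ha : 0 < a) {s : ℝ} (hs : s < 1) {y : ℝ}
    (hy : Real.cos y ≤ -a) :
    Integrable (fun x : ℝ => hankelKernel s (x + y * I)) :=
  Integrable.mono' (integrable_exp_neg_mul_exp ha (sub_pos.2 hs))
    ((continuous_hankelKernel s).comp (by fun_prop)).aestronglyMeasurable
    (ae_of_all _ fun _ => norm_hankelKernel_le hy)

/-- Independence of the line integral of the height. -/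
lemma integral_hankelKernel_line_eq {a : ℝ} (ha : 0 < a) {s : ℝ} (hs : s < 1) {t₁ t₂ : ℝ}
    (h : ∀ y ∈ uIcc t₁ t₂, Real.cos y ≤ -a) :
    ∫ x : ℝ, hankelKernel s (x + t₁ * I) = ∫ x : ℝ, hankelKernel s (x + t₂ * I) := by
  have hrect : ∀ R : ℝ, (∫ x : ℝ in (-R)..R, hankelKernel s (x + t₁ * I)) -
      (∫ x : ℝ in (-R)..R, hankelKernel s (x + t₂ * I)) +
      I * (∫ y : ℝ in t₁..t₂, hankelKernel s (R + y * I)) -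
      I * (∫ y : ℝ in t₁..t₂, hankelKernel s ((-R : ℝ) + y * I)) = 0 := by
    intro R
    have := Complex.integral_boundary_rect_eq_zero_of_differentiableOn (hankelKernel s)
      ⟨-R, t₁⟩ ⟨R, t₂⟩ (differentiable_hankelKernel s).differentiableOn
    simpa only [smul_eq_mul] using this
  have hv : ∀ x : ℝ, ‖∫ y : ℝ in t₁..t₂, hankelKernel s (x + y * I)‖ ≤
      Real.exp (-a * Real.exp x + (1 - s) * x) * |t₂ - t₁| := fun x =>
    intervalIntegral.norm_integral_le_of_norm_le_const fun y hy =>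
      norm_hankelKernel_le (h y (uIoc_subset_uIcc hy))
  have hv₁ : Tendsto (fun R : ℝ => ∫ y : ℝ in t₁..t₂, hankelKernel s (R + y * I)) atTop (𝓝 0) := by
    refine squeeze_zero_norm hv ?_
    simpa using (tendsto_exp_neg_mul_exp_atTop ha (1 - s)).mul_const |t₂ - t₁|
  have hv₂ : Tendsto (fun R : ℝ => ∫ y : ℝ in t₁..t₂, hankelKernel s ((-R : ℝ) + y * I))
      atTop (𝓝 0) := by
    refine squeeze_zero_norm (fun R => hv (-R)) ?_
    simpa using ((tendsto_exp_mul_exp_atBot (-a) (sub_pos.2 hs)).comp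
      tendsto_neg_atTop_atBot).mul_const |t₂ - t₁|
  have hl : ∀ t ∈ uIcc t₁ t₂, Tendsto (fun R : ℝ => ∫ x : ℝ in (-R)..R, hankelKernel s (x + t * I))
      atTop (𝓝 (∫ x : ℝ, hankelKernel s (x + t * I))) := fun t ht =>
    intervalIntegral_tendsto_integral (integrable_hankelKernel ha hs (h t ht))
      tendsto_neg_atTop_atBot tendsto_id
  have := (((hl t₁ left_mem_uIcc).sub (hl t₂ right_mem_uIcc)).add (hv₁.const_mul I)).sub
    (hv₂.const_mul I)
  have h0 := tendsto_nhds_unique (this.congr hrect) tendsto_const_nhds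
  simpa [sub_eq_zero] using h0

lemma integral_exp_neg_exp {c : ℝ} (hc : 0 < c) :
    ∫ x : ℝ, Real.exp (-Real.exp x + c * x) = Real.Gamma c := by
  rw [Real.Gamma_eq_integral hc, ← Real.range_exp, ← image_univ,
    integral_image_eq_integral_abs_deriv_smul MeasurableSet.univ
      (fun x _ => (Real.hasDerivAt_exp x).hasDerivWithinAt) Real.exp_injective.injOn,
    setIntegral_univ]
  congr 1 with x
  rw [abs_of_pos (Real.exp_pos x), smul_eq_mul, ← Real.exp_mul, ← Real.exp_add, ← Real.exp_add]
  ring_nf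

lemma integral_hankelKernel_pi {s : ℝ} (hs : s < 1) {t : ℝ} (ht : Complex.exp (t * I) = -1) :
    ∫ x : ℝ, hankelKernel s (x + t * I) =
      Complex.exp ((1 - s) * t * I) * Complex.Gamma ((1 - s : ℝ) : ℂ) := by
  rw [Complex.Gamma_ofReal, ← integral_exp_neg_exp (sub_pos.2 hs), ← integral_complex_ofReal,
    ← integral_const_mul]
  congr 1 with x
  rw [hankelKernel, Complex.exp_add (x : ℂ), ht, Complex.ofReal_exp, ← Complex.exp_add]
  congr 1
  push_cast
  ring

/-- Deformation of the contour to another abscissa. -/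
lemma hankelIntegral_eq {θ ρ₁ ρ₂ : ℝ} (hθ : 0 ≤ θ) {f : ℂ → ℂ}
    (hf : ∀ w : ℂ, w.re ∈ uIcc ρ₁ ρ₂ → |w.im| ≤ θ → DifferentiableAt ℂ f w)
    (h₁ : ∀ ρ ∈ uIcc ρ₁ ρ₂, IntegrableOn (fun x : ℝ => f (x + θ * I)) (Ioi ρ))
    (h₂ : ∀ ρ ∈ uIcc ρ₁ ρ₂, IntegrableOn (fun x : ℝ => f (x + (-θ : ℝ) * I)) (Ioi ρ)) :
    hankelIntegral θ ρ₁ f = hankelIntegral θ ρ₂ f := by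
  have hrect := Complex.integral_boundary_rect_eq_zero_of_differentiableOn f
      ⟨ρ₁, -θ⟩ ⟨ρ₂, θ⟩ (fun w hw => (hf w hw.1 (by
        have := hw.2
        simp only [mem_preimage] at this
        rw [uIcc_of_le (by linarith)] at this
        exact abs_le.2 this)).differentiableWithinAt)
  simp only [smul_eq_mul] at hrect
  unfold hankelIntegral
  rw [← intervalIntegral.integral_interval_add_Ioi (h₁ ρ₁ left_mem_uIcc) (h₁ ρ₂ right_mem_uIcc),
    ← intervalIntegral.integral_interval_add_Ioi (h₂ ρ₁ left_mem_uIcc) (h₂ ρ₂ right_mem_uIcc)]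
  linear_combination -hrect

lemma tendsto_hankelIntegral_hankelKernel_atBot {θ a s : ℝ} (ha : 0 < a) (hθ : Real.cos θ ≤ -a)
    (hs : s < 1) :
    Tendsto (fun ρ => hankelIntegral θ ρ (hankelKernel s)) atBot
      (𝓝 ((∫ x : ℝ, hankelKernel s (x + θ * I)) -
        ∫ x : ℝ, hankelKernel s (x + (-θ : ℝ) * I))) := by
  have hl : ∀ t : ℝ, Real.cos t ≤ -a →
      Tendsto (fun ρ : ℝ => ∫ x in Ioi ρ, hankelKernel s (x + t * I)) atBot
        (𝓝 (∫ x : ℝ, hankelKernel s (x + t * I))) := fun t ht =>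
    (aecover_Ioi tendsto_id).integral_tendsto_of_countably_generated
      (integrable_hankelKernel ha hs ht)
  have hv : Tendsto (fun ρ : ℝ => ∫ y in (-θ)..θ, hankelKernel s (ρ + y * I)) atBot (𝓝 0) := by
    refine squeeze_zero_norm (a := fun ρ : ℝ =>
      Real.exp (1 * Real.exp ρ + (1 - s) * ρ) * |θ - -θ|) (fun ρ => ?_) ?_
    · refine intervalIntegral.norm_integral_le_of_norm_le_const fun y _ => ?_
      rw [norm_hankelKernel]
      gcongr
      exact Real.cos_le_one y
    · simpa using (tendsto_exp_mul_exp_atBot 1 (sub_pos.2 hs)).mul_const |θ - -θ|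
  simpa [hankelIntegral] using ((hl θ hθ).sub (hl (-θ) (by rwa [Real.cos_neg]))).add (hv.const_mul I)

lemma hankelIntegral_hankelKernel_of_lt_one {θ s : ℝ} (hθ : Real.pi / 2 < θ) (hθ' : θ < Real.pi)
    (hs : s < 1) :
    hankelIntegral θ 0 (hankelKernel s) = 2 * Real.pi * I / Complex.Gamma s := by
  have hπ := Real.pi_pos
  have ha : 0 < -Real.cos θ :=
    neg_pos.2 (Real.cos_neg_of_pi_div_two_lt_of_lt hθ (by linarith))
  have hθn : Real.cos (-θ) ≤ - -Real.cos θ := by simp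
  have hconst : ∀ ρ, hankelIntegral θ ρ (hankelKernel s) = hankelIntegral θ 0 (hankelKernel s) :=
    fun ρ => hankelIntegral_eq (by linarith) (fun w _ _ => differentiable_hankelKernel s w)
      (fun ρ' _ => integrableOn_hankelKernel ha s ρ' (neg_neg _).ge)
      (fun ρ' _ => integrableOn_hankelKernel ha s ρ' hθn)
  have hlim := tendsto_hankelIntegral_hankelKernel_atBot ha (neg_neg _).ge hs (θ := θ)
  rw [tendsto_nhds_unique (tendsto_const_nhds.congr fun ρ => (hconst ρ).symm) hlim]
  have hup : ∀ y ∈ uIcc θ Real.pi, Real.cos y ≤ - -Real.cos θ := by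
    intro y hy
    rw [uIcc_of_le hθ'.le] at hy
    rw [neg_neg]
    exact Real.cos_le_cos_of_nonneg_of_le_pi (by linarith) hy.2 hy.1
  have hdown : ∀ y ∈ uIcc (-θ) (-Real.pi), Real.cos y ≤ - -Real.cos θ := by
    intro y hy
    rw [uIcc_of_ge (by linarith)] at hy
    rw [← Real.cos_neg y]
    refine hup (-y) ?_
    rw [uIcc_of_le hθ'.le]
    exact ⟨by linarith [hy.2], by linarith [hy.1]⟩
  rw [integral_hankelKernel_line_eq ha hs hup, integral_hankelKernel_line_eq ha hs hdown,
    integral_hankelKernel_pi hs Complex.exp_pi_mul_I,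
    integral_hankelKernel_pi hs (by simp [Complex.exp_neg, Complex.exp_pi_mul_I]),
    ← sub_mul]
  have hsin : Complex.exp ((1 - s) * Real.pi * I) - Complex.exp ((1 - s) * (-Real.pi : ℝ) * I)
      = 2 * I * Complex.sin (Real.pi * s) := by
    rw [show Complex.sin (Real.pi * s) = Complex.sin ((1 - s) * Real.pi) by
      rw [← Complex.sin_pi_sub]; ring_nf, Complex.sin]
    push_cast
    rw [show ((1 - s) * -(Real.pi : ℂ) * I) = -((1 - s) * Real.pi) * I by ring]
    linear_combination (Complex.exp ((1 - s) * Real.pi * I)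
      - Complex.exp (-((1 - s) * Real.pi) * I)) * I_sq
  rw [hsin]
  have hrefl := Complex.Gamma_mul_Gamma_one_sub (s : ℂ)
  have hne : Complex.Gamma ((1 - s : ℝ) : ℂ) ≠ 0 :=
    Complex.Gamma_ne_zero_of_re_pos (by simpa using hs)
  push_cast at hne ⊢
  by_cases h0 : Complex.sin (Real.pi * s) = 0
  · rw [h0, div_zero] at hrefl
    have : Complex.Gamma s = 0 := (mul_eq_zero.1 hrefl).resolve_right hne
    simp [h0, this]
  · have hG : Complex.Gamma s ≠ 0 := by
      intro h
      rw [h, zero_mul] at hrefl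
      exact div_ne_zero (by simp) h0 hrefl.symm
    rw [eq_div_iff h0] at hrefl
    rw [eq_div_iff hG]
    linear_combination 2 * I * hrefl

lemma hasDerivAt_hankelKernel (s : ℝ) (w : ℂ) :
    HasDerivAt (hankelKernel (s + 1)) (hankelKernel s w - s * hankelKernel (s + 1) w) w := by
  have h : HasDerivAt (fun w => Complex.exp w + (1 - (s + 1 : ℝ)) * w)
      (Complex.exp w + (1 - (s + 1 : ℝ)) * 1) w :=
    (Complex.hasDerivAt_exp w).add ((hasDerivAt_id w).const_mul _)
  refine h.cexp.congr_deriv ?_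
  rw [mul_add, ← Complex.exp_add]
  unfold hankelKernel
  push_cast
  ring_nf

lemma integral_Ioi_hankelKernel_sub {a : ℝ} (ha : 0 < a) (s ρ : ℝ) {y : ℝ} (hy : Real.cos y ≤ -a) :
    (∫ x in Ioi ρ, hankelKernel s (x + y * I)) -
      s * ∫ x in Ioi ρ, hankelKernel (s + 1) (x + y * I) = -hankelKernel (s + 1) (ρ + y * I) := by
  rw [← integral_const_mul, ← integral_sub (integrableOn_hankelKernel ha s ρ hy)
    ((integrableOn_hankelKernel ha (s + 1) ρ hy).const_mul _)]
  have hd : ∀ x ∈ Ici ρ, HasDerivAt (fun x : ℝ => hankelKernel (s + 1) (x + y * I))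
      (hankelKernel s (x + y * I) - s * hankelKernel (s + 1) (x + y * I)) x := fun x _ => by
    have h : HasDerivAt (fun x : ℝ => (x : ℂ) + y * I) 1 x :=
      (Complex.ofRealCLM.hasDerivAt (x := x)).add_const _
    exact ((hasDerivAt_hankelKernel s (x + y * I)).comp x h).congr_deriv (mul_one _)
  rw [integral_Ioi_of_hasDerivAt_of_tendsto' hd ((integrableOn_hankelKernel ha s ρ hy).sub
    ((integrableOn_hankelKernel ha (s + 1) ρ hy).const_mul _)) (m := 0), zero_sub]
  exact squeeze_zero_norm (fun x => norm_hankelKernel_le hy) (tendsto_exp_neg_mul_exp_atTop ha _)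

lemma integral_vertical_hankelKernel_sub (s ρ t : ℝ) :
    I * (∫ y in (-t)..t, hankelKernel s (ρ + y * I)) -
      s * (I * ∫ y in (-t)..t, hankelKernel (s + 1) (ρ + y * I)) =
    hankelKernel (s + 1) (ρ + t * I) - hankelKernel (s + 1) (ρ + (-t : ℝ) * I) := by
  have hi : ∀ (s c : ℂ) (r : ℝ), IntervalIntegrable
      (fun y : ℝ => c * hankelKernel r (ρ + y * I)) volume (-t) t := fun s c r =>
    (continuous_const.mul
      ((continuous_hankelKernel r).comp (by fun_prop))).intervalIntegrable _ _
  have hd : ∀ y ∈ uIcc (-t) t, HasDerivAt (fun y : ℝ => hankelKernel (s + 1) (ρ + y * I))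
      (I * hankelKernel s (ρ + y * I) - s * I * hankelKernel (s + 1) (ρ + y * I)) y :=
    fun y _ => by
    have h : HasDerivAt (fun y : ℝ => (ρ : ℂ) + y * I) (1 * I) y :=
      ((Complex.ofRealCLM.hasDerivAt (x := y)).mul_const I).const_add _
    refine ((hasDerivAt_hankelKernel s (ρ + y * I)).comp y h).congr_deriv ?_
    ring
  rw [← intervalIntegral.integral_eq_sub_of_hasDerivAt hd ((hi s _ _).sub (hi s _ _)),
    intervalIntegral.integral_sub (hi s _ _) (hi s _ _), intervalIntegral.integral_const_mul,
    intervalIntegral.integral_const_mul]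
  ring

lemma hankelIntegral_hankelKernel_succ {θ : ℝ} (hθ : Real.cos θ < 0) (s ρ : ℝ) :
    hankelIntegral θ ρ (hankelKernel s) = s * hankelIntegral θ ρ (hankelKernel (s + 1)) := by
  have h₁ := integral_Ioi_hankelKernel_sub (neg_pos.2 hθ) s ρ (neg_neg _).ge
  have h₂ := integral_Ioi_hankelKernel_sub (neg_pos.2 hθ) s ρ (y := -θ) (by simp)
  have h₃ := integral_vertical_hankelKernel_sub s ρ θ
  unfold hankelIntegral
  linear_combination h₁ - h₂ + h₃

lemma continuous_hankelKernel_param (w : ℂ) : Continuous fun s : ℝ => hankelKernel s w := by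
  unfold hankelKernel; fun_prop

lemma continuousAt_hankelIntegral_hankelKernel {θ : ℝ} (hθ : Real.cos θ < 0) (s₀ : ℝ) :
    ContinuousAt (fun s => hankelIntegral θ 0 (hankelKernel s)) s₀ := by
  have hl : ∀ t : ℝ, Real.cos t ≤ - -Real.cos θ →
      ContinuousAt (fun s => ∫ x in Ioi (0 : ℝ), hankelKernel s (x + t * I)) s₀ := by
    intro t ht
    refine continuousAt_of_dominated
      (Eventually.of_forall fun s =>
        ((continuous_hankelKernel s).comp (by fun_prop)).aestronglyMeasurable)
      ?_ (integrableOn_exp_neg_mul_exp (neg_pos.2 hθ) (1 - (s₀ - 1)) 0)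
      (ae_of_all _ fun x => (continuous_hankelKernel_param _).continuousAt)
    filter_upwards [lt_mem_nhds (sub_one_lt s₀)] with s hs
    filter_upwards [ae_restrict_mem measurableSet_Ioi] with x hx
    refine (norm_hankelKernel_le ht).trans ?_
    have : 0 ≤ x := le_of_lt hx
    gcongr
  have hv : Continuous fun s : ℝ => ∫ y in (-θ)..θ, hankelKernel s ((0 : ℝ) + y * I) := by
    refine intervalIntegral.continuous_parametric_intervalIntegral_of_continuous' ?_ _ _
    unfold Function.uncurry hankelKernel
    fun_prop
  exact ((hl θ (neg_neg _).ge).sub (hl (-θ) (by simp))).add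
    (hv.continuousAt.const_mul I)

/-- **Hankel's formula** for the reciprocal of the Gamma function. -/
lemma hankelIntegral_hankelKernel {θ : ℝ} (hθ : Real.pi / 2 < θ) (hθ' : θ < Real.pi) (s : ℝ) :
    hankelIntegral θ 0 (hankelKernel s) = 2 * Real.pi * I / Complex.Gamma s := by
  have hcos : Real.cos θ < 0 :=
    Real.cos_neg_of_pi_div_two_lt_of_lt hθ (by linarith [Real.pi_pos])
  have key : ∀ (n : ℕ) (s : ℝ), s < n + 1 →
      hankelIntegral θ 0 (hankelKernel s) = 2 * Real.pi * I / Complex.Gamma s := by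
    intro n
    induction n with
    | zero => exact fun s hs => hankelIntegral_hankelKernel_of_lt_one hθ hθ' (by simpa using hs)
    | succ n ih =>
      intro s hs
      by_cases h1 : s = 1
      · subst h1
        have hG : Continuous fun s : ℝ => 2 * Real.pi * I / Complex.Gamma s := by
          simp only [div_eq_mul_inv]
          exact continuous_const.mul
            (Complex.differentiable_one_div_Gamma.continuous.comp Complex.continuous_ofReal)
        refine tendsto_nhds_unique
          ((continuousAt_hankelIntegral_hankelKernel hcos 1).mono_left
            (nhdsWithin_le_nhds (s := Iio 1)))
          (((hG.tendsto 1).mono_left nhdsWithin_le_nhds).congr' ?_)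
        filter_upwards [self_mem_nhdsWithin] with s hs
        exact (hankelIntegral_hankelKernel_of_lt_one hθ hθ' hs).symm
      · have hrec := hankelIntegral_hankelKernel_succ hcos (s - 1) 0
        rw [ih (s - 1) (by push_cast at hs; linarith), sub_add_cancel, div_eq_mul_inv,
          Complex.one_div_Gamma_eq_self_mul_one_div_Gamma_add_one] at hrec
        have hne : ((s - 1 : ℝ) : ℂ) ≠ 0 := Complex.ofReal_ne_zero.2 (sub_ne_zero.2 h1)
        have hs1 : ((s - 1 : ℝ) : ℂ) + 1 = s := by push_cast; ring
        rw [hs1] at hrec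
        apply mul_left_cancel₀ hne
        rw [← hrec]
        ring
  obtain ⟨n, hn⟩ := exists_nat_gt s
  exact key n s (hn.trans (lt_add_one _))

lemma norm_sub_ge_of_cos_le {κ : ℝ} (hκ : -1 ≤ κ) {u z : ℂ}
    (h : Real.cos (arg u - arg z) ≤ κ) :
    √((1 - κ) / 2) * (‖u‖ + ‖z‖) ≤ ‖u - z‖ := by
  rcases le_or_gt κ 1 with hk | hk
  swap
  · rw [Real.sqrt_eq_zero_of_nonpos (by linarith), zero_mul]
    exact norm_nonneg _
  refine le_of_sq_le_sq ?_ (norm_nonneg _)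
  rw [mul_pow, Real.sq_sqrt (by linarith), ← Complex.normSq_eq_norm_sq, Complex.normSq_apply,
    Complex.sub_re, Complex.sub_im, ← Complex.norm_mul_cos_arg u, ← Complex.norm_mul_sin_arg u,
    ← Complex.norm_mul_cos_arg z, ← Complex.norm_mul_sin_arg z]
  rw [Real.cos_sub] at h
  have h₁ := mul_le_mul_of_nonneg_left h (mul_nonneg (norm_nonneg u) (norm_nonneg z))
  have h₂ := mul_nonneg (by linarith : (0 : ℝ) ≤ 1 + κ) (sq_nonneg (‖u‖ - ‖z‖))
  have h₃ := Real.sin_sq_add_cos_sq (arg u)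
  have h₄ := Real.sin_sq_add_cos_sq (arg z)
  linear_combination 2 * h₁ + h₂ / 2 - ‖u‖ ^ 2 * h₃ - ‖z‖ ^ 2 * h₄

lemma cos_sub_le_cos_sub {φ ψ a b : ℝ} (hφ : |φ| ≤ a) (hab : a ≤ b) (hψ : b ≤ |ψ|)
    (hψ' : |ψ| ≤ Real.pi) : Real.cos (φ - ψ) ≤ Real.cos (b - a) := by
  have h₁ : b - a ≤ |φ - ψ| := by
    have := abs_sub_abs_le_abs_sub ψ φ
    rw [abs_sub_comm] at this
    linarith
  have h₂ : |φ - ψ| ≤ Real.pi + a := by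
    have := abs_sub φ ψ
    linarith
  rw [← Real.cos_abs (φ - ψ)]
  rcases le_total |φ - ψ| Real.pi with h | h
  · exact Real.cos_le_cos_of_nonneg_of_le_pi (by linarith) h h₁
  · rw [← Real.cos_two_pi_sub]
    exact Real.cos_le_cos_of_nonneg_of_le_pi (by linarith) (by linarith) (by linarith)

lemma norm_one_sub_mul_exp_ge {α θ μ : ℝ} (hα : 0 ≤ α) (hθμ : α * θ ≤ μ) {z w : ℂ}
    (hz : μ ≤ |arg z|) (hw : |w.im| ≤ θ) (hθπ : α * θ < Real.pi) :
    √((1 - Real.cos (μ - α * θ)) / 2) * (Real.exp (α * w.re) + ‖z‖) ≤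
      ‖1 - z * Complex.exp (-(α * w))‖ * Real.exp (α * w.re) := by
  have him : |α * w.im| ≤ α * θ := by
    rw [abs_mul, abs_of_nonneg hα]
    gcongr
  have harg : arg (Complex.exp (α * w)) = α * w.im := by
    rw [Complex.arg_exp, (toIocMod_eq_self Real.two_pi_pos).2]
    · simp
    · have := abs_le.1 him
      simp only [Complex.im_ofReal_mul, mem_Ioc]
      constructor <;> linarith
  have hn : ‖Complex.exp (α * w)‖ = Real.exp (α * w.re) := by
    rw [Complex.norm_exp, Complex.re_ofReal_mul]
  have hmul : (1 - z * Complex.exp (-(α * w))) * Complex.exp (α * w)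
      = Complex.exp (α * w) - z := by
    rw [sub_mul, mul_assoc, ← Complex.exp_add, neg_add_cancel, Complex.exp_zero, one_mul, mul_one]
  rw [← hn, ← norm_mul, hmul]
  refine norm_sub_ge_of_cos_le (Real.neg_one_le_cos _) ?_
  rw [harg]
  exact cos_sub_le_cos_sub him hθμ hz (Complex.abs_arg_le_pi z)

lemma hankelKernel_add_mul (α β : ℝ) (k : ℕ) (z w : ℂ) :
    z ^ k * hankelKernel (α * k + β) w =
      hankelKernel β w * (z * Complex.exp (-(α * w))) ^ k := by
  rw [mul_pow, ← Complex.exp_nat_mul, mul_left_comm]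
  unfold hankelKernel
  rw [← Complex.exp_add]
  push_cast
  ring_nf

lemma hasSum_integral_hankelKernel (α β : ℝ) (z : ℂ) {m : Measure ℝ} {p : ℝ → ℂ}
    (hp : Continuous p) (hint : Integrable (fun x => hankelKernel β (p x)) m)
    (hz : ∀ᵐ x ∂m, ‖z * Complex.exp (-(α * p x))‖ ≤ 1 / 2) :
    HasSum (fun k : ℕ => z ^ k * ∫ x, hankelKernel (α * k + β) (p x) ∂m)
      (∫ x, hankelKernel β (p x) / (1 - z * Complex.exp (-(α * p x))) ∂m) := by
  simp_rw [← integral_const_mul, hankelKernel_add_mul]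
  have hK := continuous_hankelKernel β
  refine hasSum_integral_of_dominated_convergence
    (fun k x => ‖hankelKernel β (p x)‖ * (1 / 2) ^ k)
    (fun k => Continuous.aestronglyMeasurable (by fun_prop)) (fun k => ?_)
    (ae_of_all _ fun x => summable_geometric_two.mul_left _) ?_ ?_
  · filter_upwards [hz] with x hx
    rw [norm_mul, norm_pow]
    gcongr
  · simp_rw [tsum_mul_left]
    exact hint.norm.mul_const _
  · filter_upwards [hz] with x hx
    rw [div_eq_mul_inv]
    exact (hasSum_geometric_of_norm_lt_one (hx.trans_lt (by norm_num))).mul_left _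

/-- The Mittag-Leffler function as a contour integral, on a contour far enough to the right. -/
lemma mittagLeffler_eq_hankelIntegral {α : ℝ} (hα : 0 ≤ α) (β : ℝ) {θ ρ : ℝ}
    (hθ : Real.pi / 2 < θ) (hθ' : θ < Real.pi) {z : ℂ} (hz : 2 * ‖z‖ ≤ Real.exp (α * ρ)) :
    2 * Real.pi * I * mittagLeffler α β z = hankelIntegral θ ρ
      (fun w => hankelKernel β w / (1 - z * Complex.exp (-(α * w)))) := by
  have hcos : Real.cos θ < 0 :=
    Real.cos_neg_of_pi_div_two_lt_of_lt hθ (by linarith [Real.pi_pos])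
  have ha := neg_pos.2 hcos
  have hθn : Real.cos (-θ) ≤ - -Real.cos θ := by simp
  have hsmall : ∀ w : ℂ, ρ ≤ w.re → ‖z * Complex.exp (-(α * w))‖ ≤ 1 / 2 := by
    intro w hw
    have h₁ : Real.exp (-(α * w.re)) ≤ Real.exp (-(α * ρ)) := by gcongr
    have h₂ := Real.exp_pos (-(α * ρ))
    have h₃ : Real.exp (α * ρ) * Real.exp (-(α * ρ)) = 1 := by
      rw [← Real.exp_add, add_neg_cancel, Real.exp_zero]
    rw [norm_mul, Complex.norm_exp, Complex.neg_re, Complex.re_ofReal_mul]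
    nlinarith [norm_nonneg z]
  have hline : ∀ t : ℝ, Real.cos t ≤ - -Real.cos θ → _ := fun t ht =>
    hasSum_integral_hankelKernel α β z (m := volume.restrict (Ioi ρ))
      (p := fun x : ℝ => x + t * I) (by fun_prop) (integrableOn_hankelKernel ha β ρ ht) (by
        filter_upwards [ae_restrict_mem measurableSet_Ioi] with x hx
        exact hsmall _ (by simpa using le_of_lt hx))
  have hvert := hasSum_integral_hankelKernel α β z (m := volume.restrict (Ioc (-θ) θ))
      (p := fun y : ℝ => ρ + y * I) (by fun_prop)
      (((continuous_hankelKernel β).comp (by fun_prop)).integrableOn_Ioc)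
      (ae_of_all _ fun y => hsmall _ (by simp))
  have hsum := ((hline θ (neg_neg _).ge).sub (hline (-θ) hθn)).add (hvert.mul_left I)
  have hle : -θ ≤ θ := by linarith [Real.pi_pos]
  unfold hankelIntegral mittagLeffler
  rw [intervalIntegral.integral_of_le hle, ← tsum_mul_left]
  refine (hsum.congr_fun fun k => ?_).tsum_eq
  have hk := hankelIntegral_hankelKernel hθ hθ' (α * k + β)
  rw [hankelIntegral_eq (ρ₂ := ρ) (by linarith)
      (fun w _ _ => differentiable_hankelKernel _ w)
      (fun ρ' _ => integrableOn_hankelKernel ha _ ρ' (neg_neg _).ge)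
      (fun ρ' _ => integrableOn_hankelKernel ha _ ρ' hθn), hankelIntegral,
      intervalIntegral.integral_of_le hle] at hk
  linear_combination (-z ^ k) * hk

lemma norm_hankelIntegral_le {θ B : ℝ} (hθ : 0 ≤ θ) {f g : ℂ → ℂ}
    (hg₁ : IntegrableOn (fun x : ℝ => g (x + θ * I)) (Ioi 0))
    (hg₂ : IntegrableOn (fun x : ℝ => g (x + (-θ : ℝ) * I)) (Ioi 0))
    (hg₃ : IntegrableOn (fun y : ℝ => g ((0 : ℝ) + y * I)) (Ioc (-θ) θ))
    (hfg : ∀ w : ℂ, 0 ≤ w.re → |w.im| ≤ θ → ‖f w‖ ≤ B * ‖g w‖) :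
    ‖hankelIntegral θ 0 f‖ ≤ B * ((∫ x in Ioi (0 : ℝ), ‖g (x + θ * I)‖) +
      (∫ x in Ioi (0 : ℝ), ‖g (x + (-θ : ℝ) * I)‖) +
      ∫ y in Ioc (-θ) θ, ‖g ((0 : ℝ) + y * I)‖) := by
  have h : ∀ (t : Set ℝ) (p : ℝ → ℂ), MeasurableSet t →
      (∀ x ∈ t, 0 ≤ (p x).re ∧ |(p x).im| ≤ θ) → IntegrableOn (fun x => g (p x)) t →
      ‖∫ x in t, f (p x)‖ ≤ B * ∫ x in t, ‖g (p x)‖ := by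
    intro t p ht hp hi
    rw [← integral_const_mul]
    refine norm_integral_le_of_norm_le (hi.norm.const_mul B) ?_
    filter_upwards [ae_restrict_mem ht] with x hx
    exact hfg _ (hp x hx).1 (hp x hx).2
  have h₁ := h (Ioi 0) _ measurableSet_Ioi
    (fun x hx => by simpa [abs_of_nonneg hθ] using le_of_lt hx) hg₁
  have h₂ := h (Ioi 0) _ measurableSet_Ioi
    (fun x hx => by simpa [abs_of_nonneg hθ] using le_of_lt hx) hg₂
  have h₃ := h (Ioc (-θ) θ) _ measurableSet_Ioc
    (fun y hy => by simpa using abs_le.2 ⟨hy.1.le, hy.2⟩) hg₃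
  rw [hankelIntegral, intervalIntegral.integral_of_le (by linarith)]
  refine (norm_add_le _ _).trans ?_
  rw [norm_mul, Complex.norm_I, one_mul]
  have := norm_sub_le (∫ x in Ioi (0 : ℝ), f (x + θ * I))
    (∫ x in Ioi (0 : ℝ), f (x + (-θ : ℝ) * I))
  linarith

lemma norm_hankelKernel_sub (α β : ℝ) (w : ℂ) :
    ‖hankelKernel (β - α) w‖ = ‖hankelKernel β w‖ * Real.exp (α * w.re) := by
  rw [← Complex.re_add_im w, norm_hankelKernel, norm_hankelKernel, ← Real.exp_add]
  simp
  ring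

theorem stmt_6 (α β μ : ℝ) (hα0 : 0 < α) (hα2 : α < 2)
    (hμ1 : Real.pi * α / 2 < μ) (hμ2 : μ < min Real.pi (Real.pi * α)) :
    ∃ C > (0 : ℝ), ∀ z : ℂ, μ ≤ |Complex.arg z| → |Complex.arg z| ≤ Real.pi →
      ‖mittagLeffler α β z‖ ≤ C / (1 + ‖z‖) := by
  have hπ := Real.pi_pos
  obtain ⟨hμπ, hμα⟩ := lt_min_iff.1 hμ2
  obtain ⟨θ, hθ, hθμ⟩ : ∃ θ, Real.pi / 2 < θ ∧ θ < μ / α :=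
    exists_between (by rw [lt_div_iff₀ hα0]; linarith)
  have hθ' : θ < Real.pi := hθμ.trans (by rwa [div_lt_iff₀ hα0])
  rw [lt_div_iff₀ hα0, mul_comm] at hθμ
  have hθ0 : 0 < θ := by linarith
  have hαθ : 0 < α * θ := by positivity
  have hcos : Real.cos θ < 0 := Real.cos_neg_of_pi_div_two_lt_of_lt hθ (by linarith)
  have ha := neg_pos.2 hcos
  have hθn : Real.cos (-θ) ≤ - -Real.cos θ := by simp
  set c : ℝ := √((1 - Real.cos (μ - α * θ)) / 2) with hc
  have hc0 : 0 < c := by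
    have : Real.cos (μ - α * θ) < Real.cos 0 :=
      Real.cos_lt_cos_of_nonneg_of_le_pi le_rfl (by linarith) (by linarith)
    rw [Real.cos_zero] at this
    exact Real.sqrt_pos.2 (by linarith)
  set M : ℝ := (∫ x in Ioi (0 : ℝ), ‖hankelKernel (β - α) (x + θ * I)‖) +
      (∫ x in Ioi (0 : ℝ), ‖hankelKernel (β - α) (x + (-θ : ℝ) * I)‖) +
      ∫ y in Ioc (-θ) θ, ‖hankelKernel (β - α) ((0 : ℝ) + y * I)‖ with hM
  have hM0 : 0 ≤ M := by positivity
  refine ⟨(M + 1) / (2 * Real.pi * c), by positivity, fun z hz _ => ?_⟩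
  set f : ℂ → ℂ := fun w => hankelKernel β w / (1 - z * Complex.exp (-(α * w))) with hf
  have hden : ∀ w : ℂ, |w.im| ≤ θ → c * (Real.exp (α * w.re) + ‖z‖) ≤
      ‖1 - z * Complex.exp (-(α * w))‖ * Real.exp (α * w.re) := fun w hw =>
    norm_one_sub_mul_exp_ge hα0.le hθμ.le hz hw (by linarith)
  have hne : ∀ w : ℂ, |w.im| ≤ θ → 1 - z * Complex.exp (-(α * w)) ≠ 0 := by
    intro w hw h
    have h₁ := hden w hw
    rw [h, norm_zero, zero_mul] at h₁
    have : 0 < c * (Real.exp (α * w.re) + ‖z‖) := by positivity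
    linarith
  have hbound : ∀ w : ℂ, 0 ≤ w.re → |w.im| ≤ θ →
      ‖f w‖ ≤ 1 / (c * (1 + ‖z‖)) * ‖hankelKernel (β - α) w‖ := by
    intro w hw hw'
    have h₁ : 1 ≤ Real.exp (α * w.re) := Real.one_le_exp (by positivity)
    have h₂ : c * (1 + ‖z‖) ≤ ‖1 - z * Complex.exp (-(α * w))‖ * Real.exp (α * w.re) :=
      le_trans (by gcongr) (hden w hw')
    rw [norm_hankelKernel_sub, hf, norm_div, div_mul_eq_mul_div, one_mul,
      div_le_div_iff₀ (norm_pos_iff.2 (hne w hw')) (by positivity)]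
    have := mul_le_mul_of_nonneg_left h₂ (norm_nonneg (hankelKernel β w))
    linarith
  have hint : ∀ t : ℝ, |t| ≤ θ → Real.cos t ≤ - -Real.cos θ → ∀ ρ : ℝ, 0 ≤ ρ →
      IntegrableOn (fun x : ℝ => f (x + t * I)) (Ioi ρ) := by
    intro t ht ht' ρ hρ
    have hK := (continuous_hankelKernel β).measurable
    refine Integrable.mono' ((integrableOn_hankelKernel ha (β - α) ρ ht').norm.const_mul
      (1 / (c * (1 + ‖z‖)))) (Measurable.aestronglyMeasurable (by fun_prop)) ?_
    filter_upwards [ae_restrict_mem measurableSet_Ioi] with x hx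
    exact hbound _ (by simpa using hρ.trans (le_of_lt hx)) (by simpa using ht)
  obtain ⟨ρ, hρ0, hρ⟩ : ∃ ρ : ℝ, 0 ≤ ρ ∧ 2 * ‖z‖ ≤ Real.exp (α * ρ) := by
    refine ⟨2 * ‖z‖ / α, by positivity, ?_⟩
    rw [mul_div_cancel₀ _ hα0.ne']
    linarith [Real.add_one_le_exp (2 * ‖z‖)]
  have hE : 2 * Real.pi * I * mittagLeffler α β z = hankelIntegral θ ρ f :=
    mittagLeffler_eq_hankelIntegral hα0.le β hθ hθ' hρ
  rw [← hankelIntegral_eq (ρ₁ := 0) (f := f) hθ0.le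
    (fun w _ hw => (differentiable_hankelKernel β w).div (by fun_prop) (hne w hw))
    (fun ρ' hρ' => hint θ (abs_of_pos hθ0).le (neg_neg _).ge ρ'
      (by rw [uIcc_of_le hρ0] at hρ'; exact hρ'.1))
    (fun ρ' hρ' => hint (-θ) (by rw [abs_neg, abs_of_pos hθ0]) hθn ρ'
      (by rw [uIcc_of_le hρ0] at hρ'; exact hρ'.1))] at hE
  have hJ := norm_hankelIntegral_le hθ0.le (integrableOn_hankelKernel ha (β - α) 0 (neg_neg _).ge)
    (integrableOn_hankelKernel ha (β - α) 0 hθn)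
    (((continuous_hankelKernel (β - α)).comp (by fun_prop)).integrableOn_Ioc) hbound
  rw [← hM] at hJ
  have hnorm : 2 * Real.pi * ‖mittagLeffler α β z‖ ≤ 1 / (c * (1 + ‖z‖)) * M := by
    refine le_of_eq_of_le ?_ hJ
    rw [← hE]
    simp [abs_of_pos hπ]
  have hM1 : 1 / (c * (1 + ‖z‖)) * M ≤ 1 / (c * (1 + ‖z‖)) * (M + 1) := by
    gcongr
    linarith
  rw [show (M + 1) / (2 * Real.pi * c) / (1 + ‖z‖)
      = 1 / (c * (1 + ‖z‖)) * (M + 1) / (2 * Real.pi) by field_simp,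
    le_div_iff₀ (by positivity)]
  linarith
end

section
/- Let 0 < α < 1 and β > 0. Then there exists a constant C > 0, depending only on α and β, such that for every λ > 0 and every real number t, |E_{α,β}(iλ t)| ≤ C / (1 + λ|t|). -/
open MeasureTheory Set Complex

lemma rpow_mul_exp_le_Gamma {M s : ℝ} (hM : 0 < M) (hs : 1 ≤ s) :
    M ^ (s - 1) * Real.exp (-(M + 1)) ≤ Real.Gamma s := by
  have hintegrable := Real.GammaIntegral_convergent (s := s) (by linarith)
  have hsub : Ioc M (M + 1) ⊆ Ioi 0 := fun x hx => hM.trans hx.1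
  have hconst : ∫ _ in Ioc M (M + 1), M ^ (s - 1) * Real.exp (-(M + 1)) =
      M ^ (s - 1) * Real.exp (-(M + 1)) := by simp
  rw [Real.Gamma_eq_integral (by linarith), ← hconst]
  refine le_trans
    (setIntegral_mono_on (integrable_const _) (hintegrable.mono_set hsub) measurableSet_Ioc ?_)
    (setIntegral_mono_set hintegrable ?_ hsub.eventuallyLE)
  · intro x hx
    rw [mul_comm]
    have := hx.1
    have := hx.2
    gcongr
  · filter_upwards [ae_restrict_mem measurableSet_Ioi] with x hx
    have : 0 < x := hx
    simp only [Pi.zero_apply]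
    positivity

lemma summable_pow_div_Gamma {α β : ℝ} (hα : 0 < α) (R : ℝ) :
    Summable fun k : ℕ => R ^ k / Real.Gamma (α * k + β) := by
  set M : ℝ := (2 * (|R| + 1)) ^ α⁻¹ with hM
  have hM0 : 0 < M := by positivity
  have hMα : M ^ α = 2 * (|R| + 1) := by
    rw [hM, ← Real.rpow_mul (by positivity), inv_mul_cancel₀ hα.ne', Real.rpow_one]
  have hg : Summable fun k : ℕ => (M ^ (β - 1) * Real.exp (-(M + 1)))⁻¹ * (1 / 2 : ℝ) ^ k :=
    (summable_geometric_of_lt_one (by norm_num) (by norm_num)).mul_left _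
  refine hg.of_norm_bounded_eventually_nat ?_
  filter_upwards [Filter.eventually_ge_atTop ⌈(1 - β) / α⌉₊] with k hk
  have hk' : 1 ≤ α * k + β := by
    have := Nat.ceil_le.1 hk
    rw [div_le_iff₀ hα] at this
    linarith
  have hG := rpow_mul_exp_le_Gamma hM0 hk'
  have hsplit : M ^ (α * k + β - 1) = (2 * (|R| + 1)) ^ k * M ^ (β - 1) := by
    rw [← hMα, ← Real.rpow_mul_natCast hM0.le, ← Real.rpow_add hM0]
    ring_nf
  rw [hsplit] at hG
  have hGpos : 0 < Real.Gamma (α * k + β) := Real.Gamma_pos_of_pos (by linarith)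
  rw [norm_div, norm_pow, Real.norm_eq_abs, Real.norm_eq_abs, abs_of_pos hGpos,
    div_le_iff₀ hGpos]
  have hD : 0 < M ^ (β - 1) * Real.exp (-(M + 1)) := by positivity
  calc |R| ^ k ≤ (|R| + 1) ^ k := by gcongr; linarith
    _ = (M ^ (β - 1) * Real.exp (-(M + 1)))⁻¹ * (1 / 2 : ℝ) ^ k *
        ((2 * (|R| + 1)) ^ k * M ^ (β - 1) * Real.exp (-(M + 1))) := by
      rw [mul_pow, one_div, inv_pow]
      field_simp
    _ ≤ _ := by gcongr

lemma norm_mittagLeffler_term_le {α β : ℝ} (hα : 0 < α) (hβ : 0 < β) {R : ℝ} (k : ℕ) {w : ℂ}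
    (hw : ‖w‖ ≤ R) :
    ‖w ^ k / Complex.Gamma (((α * k + β : ℝ) : ℂ))‖ ≤ R ^ k / Real.Gamma (α * k + β) := by
  have hGpos : 0 < Real.Gamma (α * k + β) := Real.Gamma_pos_of_pos (by positivity)
  rw [Complex.Gamma_ofReal, norm_div, norm_pow, Complex.norm_real, Real.norm_of_nonneg hGpos.le]
  gcongr

lemma differentiable_mittagLeffler {α β : ℝ} (hα : 0 < α) (hβ : 0 < β) :
    Differentiable ℂ (mittagLeffler α β) := by
  intro z
  have h := Complex.differentiableOn_tsum_of_summable_norm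
    (F := fun (k : ℕ) w => w ^ k / Complex.Gamma (((α * k + β : ℝ) : ℂ)))
    (summable_pow_div_Gamma (β := β) hα (‖z‖ + 1)) (U := Metric.ball 0 (‖z‖ + 1))
    (fun k => by fun_prop) Metric.isOpen_ball
    (fun k w hw => norm_mittagLeffler_term_le hα hβ k (by simpa using (mem_ball_zero_iff.1 hw).le))
  exact h.differentiableAt (Metric.isOpen_ball.mem_nhds (by simp))

lemma mittagLeffler_eq_deriv {α β : ℝ} (hα : 0 < α) (hβ : 0 < β) (z : ℂ) :
    mittagLeffler α β z =
      α * z * deriv (mittagLeffler α (β + 1)) z + β * mittagLeffler α (β + 1) z := by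
  have hβ1 : 0 < β + 1 := by linarith
  have hterm : ∀ (k : ℕ) (w : ℂ), w ∈ Metric.ball (0 : ℂ) (‖z‖ + 1) →
      ‖w ^ k / Complex.Gamma (((α * k + (β + 1) : ℝ) : ℂ))‖ ≤
        (‖z‖ + 1) ^ k / Real.Gamma (α * k + (β + 1)) := fun k w hw =>
    norm_mittagLeffler_term_le hα hβ1 k (by simpa using (mem_ball_zero_iff.1 hw).le)
  have hz : z ∈ Metric.ball (0 : ℂ) (‖z‖ + 1) := by simp
  have hs := summable_pow_div_Gamma (β := β + 1) hα (‖z‖ + 1)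
  have h1 := Complex.hasSum_deriv_of_summable_norm
    (F := fun (k : ℕ) w => w ^ k / Complex.Gamma (((α * k + (β + 1) : ℝ) : ℂ)))
    hs (fun k => by fun_prop) Metric.isOpen_ball hterm hz
  have h0 := (Summable.of_norm_bounded hs fun k => hterm k z hz).hasSum
  refine ((tsum_congr fun k => ?_).trans
    ((h1.mul_left (α * z)).add (h0.mul_left (β : ℂ))).tsum_eq)
  have hpos : 0 < α * k + β := by positivity
  have hG : Complex.Gamma ((α * k + β : ℝ) : ℂ) ≠ 0 := by
    rw [Complex.Gamma_ofReal]
    exact_mod_cast (Real.Gamma_pos_of_pos hpos).ne'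
  have hne : ((α * k + β : ℝ) : ℂ) ≠ 0 := by exact_mod_cast hpos.ne'
  have hd : deriv (fun w : ℂ => w ^ k / Complex.Gamma (((α * k + (β + 1) : ℝ) : ℂ))) z =
      k * z ^ (k - 1) / Complex.Gamma (((α * k + (β + 1) : ℝ) : ℂ)) := by simp
  have hk : (k : ℂ) * z ^ (k - 1) * z = k * z ^ k := by
    rcases k with _ | k
    · simp
    · rw [Nat.add_sub_cancel, pow_succ, mul_assoc]
  have hrec : Complex.Gamma (((α * k + (β + 1) : ℝ) : ℂ)) =
      ((α * k + β : ℝ) : ℂ) * Complex.Gamma ((α * k + β : ℝ) : ℂ) := by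
    rw [← Complex.Gamma_add_one _ hne]
    push_cast
    ring_nf
  rw [hd, hrec]
  field_simp
  push_cast
  linear_combination (-α : ℂ) * hk

lemma mul_norm_add_norm_le_norm_sub {κ₁ κ : ℝ} (hκ : 0 ≤ κ) (hκ₁ : κ < κ₁) (h1 : κ₁ ≤ 1) {w z : ℂ}
    (hw : κ₁ * ‖w‖ ≤ w.re) (hz : z.re < κ * ‖z‖) :
    (κ₁ - κ) / 4 * (‖w‖ + ‖z‖) ≤ ‖w - z‖ := by
  have h2 : w.re - z.re ≤ ‖w - z‖ := by simpa using Complex.re_le_norm (w - z)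
  have h3 : ‖z‖ - ‖w‖ ≤ ‖w - z‖ := by rw [norm_sub_rev]; exact norm_sub_norm_le z w
  nlinarith [norm_nonneg (w - z), norm_nonneg w, norm_nonneg z]

lemma isPreconnected_re_lt {κ : ℝ} (hκ : 0 ≤ κ) (h1 : κ ≤ 1) :
    IsPreconnected {z : ℂ | z.re < κ * ‖z‖} := by
  refine (StarConvex.isPathConnected (a := (-1 : ℂ)) ?_ ?_).isConnected.isPreconnected
  · rintro z hz a b ha hb hab
    have hz' : z.re < κ * ‖z‖ := hz
    have h2 : b * ‖z‖ - a ≤ ‖a • (-1 : ℂ) + b • z‖ := by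
      have := norm_sub_norm_le (b • z) (-(a • (-1 : ℂ)))
      rw [sub_neg_eq_add, add_comm (b • z)] at this
      simpa [norm_smul, abs_of_nonneg ha, abs_of_nonneg hb] using this
    have h3 : (a • (-1 : ℂ) + b • z).re = -a + b * z.re := by simp
    simp only [mem_ofPred_eq]
    rw [h3]
    rcases hb.eq_or_lt with rfl | hb
    · have : a = 1 := by linarith
      subst this
      simp
      linarith
    · nlinarith [mul_le_mul_of_nonneg_left h2 hκ, mul_lt_mul_of_pos_left hz' hb]
  · simp
    linarith

lemma integral_rpow_mul_cexp_neg_mul_Ioi {s : ℝ} (hs : 0 < s) {r : ℂ} (hr : 0 < r.re) :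
    ∫ x in Ioi (0 : ℝ), ((x ^ (s - 1) : ℝ) : ℂ) * cexp (-(r * x)) = r ^ (-s : ℂ) * Real.Gamma s := by
  have hopen : IsOpen {r : ℂ | 0 < r.re} := isOpen_lt continuous_const Complex.continuous_re
  have hmeas : ∀ r : ℂ, AEStronglyMeasurable
      (fun x : ℝ => ((x ^ (s - 1) : ℝ) : ℂ) * cexp (-(r * x))) (volume.restrict (Ioi 0)) :=
    fun r => by
      refine Measurable.aestronglyMeasurable ?_
      fun_prop
  have hintegrable : ∀ r : ℂ, 0 < r.re → IntegrableOn
      (fun x : ℝ => ((x ^ (s - 1) : ℝ) : ℂ) * cexp (-(r * x))) (Ioi 0) := by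
    intro r hr
    refine (integrableOn_rpow_mul_exp_neg_mul_rpow (s := s - 1) (by linarith) one_pos hr).mono'
      (hmeas r) ?_
    filter_upwards [ae_restrict_mem measurableSet_Ioi] with x hx
    have : 0 < x := hx
    simp [Complex.norm_exp, abs_of_pos (Real.rpow_pos_of_pos this (s - 1))]
  have hdiff : DifferentiableOn ℂ
      (fun r : ℂ => ∫ x in Ioi (0 : ℝ), ((x ^ (s - 1) : ℝ) : ℂ) * cexp (-(r * x)))
      {r : ℂ | 0 < r.re} := by
    intro r hr
    have hr' : 0 < r.re := hr
    have hnhds : {w : ℂ | r.re / 2 < w.re} ∈ nhds r :=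
      (isOpen_lt continuous_const Complex.continuous_re).mem_nhds (by simp; linarith)
    refine (hasDerivAt_integral_of_dominated_loc_of_deriv_le
      (F' := fun w (x : ℝ) => ((x ^ (s - 1) : ℝ) : ℂ) * (cexp (-(w * x)) * (-x)))
      (bound := fun x : ℝ => x ^ s * Real.exp (-(r.re / 2) * x ^ (1 : ℝ)))
      hnhds (Filter.Eventually.of_forall hmeas) (hintegrable r hr) ?_ ?_
      (integrableOn_rpow_mul_exp_neg_mul_rpow (by linarith) one_pos (by linarith))
      ?_).2.differentiableAt.differentiableWithinAt
    · refine Measurable.aestronglyMeasurable ?_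
      fun_prop
    · filter_upwards [ae_restrict_mem measurableSet_Ioi] with x hx w hw
      have hx : 0 < x := hx
      have hw : r.re / 2 < w.re := hw
      have hxs : x ^ s = x ^ (s - 1) * x := by
        rw [← Real.rpow_add_one hx.ne', sub_add_cancel]
      rw [hxs, norm_mul, norm_mul, norm_neg, Complex.norm_real, Complex.norm_real,
        Complex.norm_exp, Real.norm_of_nonneg hx.le, Real.norm_of_nonneg (by positivity),
        Real.rpow_one, mul_assoc, mul_comm x]
      gcongr
      simp
      nlinarith
    · refine Filter.Eventually.of_forall fun x w _ => ?_
      have h := (((hasDerivAt_id w).mul_const (x : ℂ)).neg.cexp).const_mul ((x ^ (s - 1) : ℝ) : ℂ)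
      simpa using h
  have hpow : DifferentiableOn ℂ (fun r : ℂ => r ^ (-s : ℂ) * Real.Gamma s) {r : ℂ | 0 < r.re} := by
    intro r hr
    refine DifferentiableAt.differentiableWithinAt ?_
    exact (differentiableAt_id.cpow_const (Or.inl hr)).mul_const _
  refine AnalyticOnNhd.eqOn_of_preconnected_of_frequently_eq (hdiff.analyticOnNhd hopen)
    (hpow.analyticOnNhd hopen) (convex_halfSpace_re_gt 0).isPreconnected (z₀ := 1) (by simp) ?_ hr
  have htend : Filter.Tendsto (fun t : ℝ => (t : ℂ)) (nhdsWithin 1 {1}ᶜ) (nhdsWithin 1 {1}ᶜ) := by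
    refine tendsto_nhdsWithin_of_tendsto_nhds_of_eventually_within _ ?_ ?_
    · exact (Complex.continuous_ofReal.tendsto' 1 1 (by simp)).mono_left nhdsWithin_le_nhds
    · filter_upwards [self_mem_nhdsWithin] with t ht
      simpa using ht
  refine htend.frequently (Filter.Eventually.frequently ?_)
  filter_upwards [mem_nhdsWithin_of_mem_nhds (Ioi_mem_nhds zero_lt_one)] with t ht
  have ht : 0 < t := ht
  have h := Complex.integral_cpow_mul_exp_neg_mul_Ioi (a := s) (by simpa using hs) ht
  rw [one_div, Complex.inv_cpow _ _ (by rw [Complex.arg_ofReal_of_nonneg ht.le]; exact Real.pi_pos.ne),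
    Complex.Gamma_ofReal, ← Complex.cpow_neg] at h
  rw [← h]
  refine setIntegral_congr_fun measurableSet_Ioi fun x hx => ?_
  have hx : 0 < x := hx
  simp [Complex.ofReal_cpow hx.le]

/-- The vertical line `Re u = 1`, parametrised by frequency. -/
noncomputable def bromwichLine (ξ : ℝ) : ℂ := 1 + ((2 * Real.pi * ξ : ℝ) : ℂ) * I

lemma continuous_bromwichLine : Continuous bromwichLine := by
  unfold bromwichLine
  fun_prop

lemma bromwichLine_re (ξ : ℝ) : (bromwichLine ξ).re = 1 := by
  simp [bromwichLine]

lemma bromwichLine_ne_zero (ξ : ℝ) : bromwichLine ξ ≠ 0 := fun h => by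
  simpa [h] using bromwichLine_re ξ

lemma one_le_norm_bromwichLine (ξ : ℝ) : 1 ≤ ‖bromwichLine ξ‖ := by
  simpa [bromwichLine_re] using Complex.re_le_norm (bromwichLine ξ)

lemma norm_cexp_bromwichLine (ξ : ℝ) : ‖cexp (bromwichLine ξ)‖ = Real.exp 1 := by
  rw [Complex.norm_exp, bromwichLine_re]

lemma continuous_bromwichLine_cpow (s : ℂ) : Continuous fun ξ => bromwichLine ξ ^ s :=
  continuous_bromwichLine.cpow continuous_const fun ξ => Or.inl (by simp [bromwichLine_re])

lemma integrable_norm_bromwichLine_rpow {r : ℝ} (hr : 1 < r) :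
    Integrable fun ξ => ‖bromwichLine ξ‖ ^ (-r) := by
  have hc : Continuous fun ξ => ‖bromwichLine ξ‖ ^ (-r) :=
    continuous_bromwichLine.norm.rpow_const fun ξ =>
      Or.inl (norm_ne_zero_iff.2 (bromwichLine_ne_zero ξ))
  refine ((integrable_one_add_norm (E := ℝ) (μ := volume) (r := r) (by simpa using hr)).const_mul
    ((2 : ℝ) ^ r)).mono' hc.aestronglyMeasurable (Filter.Eventually.of_forall fun ξ => ?_)
  have h1 := one_le_norm_bromwichLine ξ
  have h2 : |ξ| ≤ ‖bromwichLine ξ‖ := by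
    have h := Complex.abs_im_le_norm (bromwichLine ξ)
    have h3 : (bromwichLine ξ).im = 2 * Real.pi * ξ := by simp [bromwichLine]
    rw [h3, abs_mul, abs_of_pos Real.two_pi_pos] at h
    nlinarith [abs_nonneg ξ, Real.pi_gt_three]
  have h4 : (1 + |ξ|) / 2 ≤ ‖bromwichLine ξ‖ := by linarith
  have h5 : 0 < 1 + |ξ| := by positivity
  rw [Real.norm_of_nonneg (by positivity), Real.norm_eq_abs]
  calc ‖bromwichLine ξ‖ ^ (-r) ≤ ((1 + |ξ|) / 2) ^ (-r) :=
        Real.rpow_le_rpow_of_nonpos (by positivity) h4 (by linarith)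
    _ = 2 ^ r * (1 + |ξ|) ^ (-r) := by
        rw [Real.div_rpow h5.le (by norm_num), Real.rpow_neg (by norm_num : (0:ℝ) ≤ 2)]
        field_simp

lemma integral_cexp_mul_bromwichLine_cpow {s : ℝ} (hs : 1 < s) :
    ∫ ξ, cexp (bromwichLine ξ) * bromwichLine ξ ^ (-s : ℂ) = (Complex.Gamma s)⁻¹ := by
  set f : ℝ → ℂ := (Ioi 0).indicator fun x => ((x ^ (s - 1) : ℝ) : ℂ) * cexp (-x) with hf
  have hG : (Real.Gamma s : ℂ) ≠ 0 := by
    exact_mod_cast (Real.Gamma_pos_of_pos (by linarith)).ne'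
  have hfi : Integrable f := by
    rw [hf, integrable_indicator_iff measurableSet_Ioi]
    have h : IntegrableOn (fun x : ℝ => ((Real.exp (-x) * x ^ (s - 1) : ℝ) : ℂ)) (Ioi 0) :=
      (Real.GammaIntegral_convergent (by linarith)).ofReal
    refine h.congr_fun (fun x _ => ?_) measurableSet_Ioi
    simp [mul_comm]
  have hF : FourierTransform.fourier f =
      fun ξ => bromwichLine ξ ^ (-s : ℂ) * Real.Gamma s := by
    ext ξ
    rw [Real.fourier_real_eq_integral_exp_smul,
      ← integral_rpow_mul_cexp_neg_mul_Ioi (by linarith) (by simp [bromwichLine_re]),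
      ← integral_indicator measurableSet_Ioi]
    congr 1 with x
    by_cases hx : x ∈ Ioi (0 : ℝ)
    · simp only [hf, indicator_of_mem hx, smul_eq_mul, bromwichLine]
      rw [mul_left_comm, ← Complex.exp_add]
      congr 2
      push_cast
      ring
    · simp [hf, indicator_of_notMem hx]
  have hFi : Integrable (FourierTransform.fourier f) := by
    rw [hF]
    refine Integrable.mul_const ?_ _
    refine (integrable_norm_bromwichLine_rpow hs).mono'
      (continuous_bromwichLine_cpow _).aestronglyMeasurable
      (Filter.Eventually.of_forall fun ξ => ?_)
    rw [← Complex.ofReal_neg, norm_cpow_real]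
  have hcont : ContinuousAt f 1 := by
    have h : ContinuousAt (fun x : ℝ => ((x ^ (s - 1) : ℝ) : ℂ) * cexp (-x)) 1 := by
      have := Real.continuousAt_rpow_const 1 (s - 1) (Or.inl one_ne_zero)
      fun_prop
    refine h.congr ?_
    filter_upwards [Ioi_mem_nhds zero_lt_one] with x hx
    rw [hf, indicator_of_mem (show x ∈ Ioi 0 from hx)]
  have hinv := hfi.fourierInv_fourier_eq hFi hcont
  have hf1 : f 1 = cexp (-1) := by simp [hf]
  rw [Real.fourierInv_eq', hF, hf1] at hinv
  rw [Complex.Gamma_ofReal, ← mul_eq_one_iff_eq_inv₀ hG, ← integral_mul_const]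
  have hexp : cexp 1 * cexp (-1) = 1 := by rw [← Complex.exp_add]; simp
  rw [← hexp, ← hinv, ← integral_const_mul]
  congr 1 with ξ
  simp only [bromwichLine, smul_eq_mul]
  rw [Complex.exp_add]
  simp
  ring_nf

lemma norm_bromwichLine_cpow (r ξ : ℝ) : ‖bromwichLine ξ ^ (-r : ℂ)‖ = ‖bromwichLine ξ‖ ^ (-r) := by
  rw [← Complex.ofReal_neg, norm_cpow_real]

lemma norm_bromwichLine_cpow_le_one {r : ℝ} (hr : 0 ≤ r) (ξ : ℝ) :
    ‖bromwichLine ξ ^ (-r : ℂ)‖ ≤ 1 := by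
  rw [norm_bromwichLine_cpow]
  exact Real.rpow_le_one_of_one_le_of_nonpos (one_le_norm_bromwichLine ξ) (by linarith)

/-- The integrand of the Bromwich representation of the Mittag-Leffler function. -/
noncomputable def bromwichKernel (α β : ℝ) (z : ℂ) (ξ : ℝ) : ℂ :=
  cexp (bromwichLine ξ) * bromwichLine ξ ^ (-β : ℂ) / (1 - z * bromwichLine ξ ^ (-α : ℂ))

lemma measurable_bromwichKernel (α β : ℝ) (z : ℂ) : Measurable (bromwichKernel α β z) := by
  unfold bromwichKernel
  have h0 := continuous_bromwichLine.cexp.measurable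
  have h1 := (continuous_bromwichLine_cpow (-α)).measurable
  have h2 := (continuous_bromwichLine_cpow (-β)).measurable
  fun_prop

lemma mittagLeffler_eq_integral_of_norm_lt_one {α β : ℝ} (hα : 0 < α) (hβ : 1 < β) {z : ℂ}
    (hz : ‖z‖ < 1) : mittagLeffler α β z = ∫ ξ, bromwichKernel α β z ξ := by
  set F : ℕ → ℝ → ℂ := fun k ξ =>
    z ^ k * (cexp (bromwichLine ξ) * bromwichLine ξ ^ (-(α * k + β : ℝ) : ℂ)) with hF
  have hFint : ∀ k, ∫ ξ, F k ξ = z ^ k / Complex.Gamma (((α * k + β : ℝ) : ℂ)) := fun k => by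
    have hk : 1 < α * k + β := by
      have : 0 ≤ α * k := by positivity
      linarith
    rw [hF, integral_const_mul, integral_cexp_mul_bromwichLine_cpow hk, div_eq_mul_inv]
  have hFeq : ∀ k ξ, F k ξ = cexp (bromwichLine ξ) * bromwichLine ξ ^ (-β : ℂ) *
      (z * bromwichLine ξ ^ (-α : ℂ)) ^ k := fun k ξ => by
    have h : (-(α * k + β : ℝ) : ℂ) = -β + -α * k := by
      push_cast
      ring
    simp only [hF]
    rw [h, Complex.cpow_add _ _ (bromwichLine_ne_zero ξ), Complex.cpow_mul_nat]
    ring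
  have hbound : ∀ k ξ, ‖F k ξ‖ ≤ ‖z‖ ^ k * (Real.exp 1 * ‖bromwichLine ξ‖ ^ (-β)) := fun k ξ => by
    rw [hFeq, norm_mul, norm_mul, norm_cexp_bromwichLine, norm_bromwichLine_cpow, norm_pow,
      norm_mul, mul_comm]
    gcongr
    exact mul_le_of_le_one_right (norm_nonneg z) (norm_bromwichLine_cpow_le_one hα.le ξ)
  have hdom := (integrable_norm_bromwichLine_rpow hβ).const_mul (Real.exp 1)
  have hFi : ∀ k, Integrable (F k) := fun k =>
    (hdom.const_mul (‖z‖ ^ k)).mono'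
      (continuous_const.mul (continuous_bromwichLine.cexp.mul
        (continuous_bromwichLine_cpow _))).aestronglyMeasurable
      (Filter.Eventually.of_forall (hbound k))
  have hsum : Summable fun k => ∫ ξ, ‖F k ξ‖ := by
    refine Summable.of_nonneg_of_le (fun k => integral_nonneg fun ξ => norm_nonneg _)
      (fun k => ?_) ((summable_geometric_of_lt_one (norm_nonneg z) hz).mul_right
        (∫ ξ, Real.exp 1 * ‖bromwichLine ξ‖ ^ (-β)))
    rw [← integral_const_mul]
    exact integral_mono (hFi k).norm (hdom.const_mul _) (hbound k)
  have h := hasSum_integral_of_summable_integral_norm hFi hsum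
  simp_rw [hFint] at h
  rw [mittagLeffler, h.tsum_eq]
  congr 1 with ξ
  have hlt : ‖z * bromwichLine ξ ^ (-α : ℂ)‖ < 1 := by
    rw [norm_mul]
    exact (mul_le_of_le_one_right (norm_nonneg z)
      (norm_bromwichLine_cpow_le_one hα.le ξ)).trans_lt hz
  simp_rw [hFeq]
  rw [tsum_mul_left, tsum_geometric_of_norm_lt_one hlt, bromwichKernel, div_eq_mul_inv]

lemma cos_mul_norm_le_re_cpow {α : ℝ} (hα : 0 ≤ α) (hα1 : α ≤ 1) {u : ℂ} (hu : 0 ≤ u.re) :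
    Real.cos (α * (Real.pi / 2)) * ‖u ^ (α : ℂ)‖ ≤ (u ^ (α : ℂ)).re := by
  rw [Complex.cpow_ofReal_re, norm_cpow_real, mul_comm]
  have harg := Complex.abs_arg_le_pi_div_two_iff.2 hu
  gcongr
  rw [← Real.cos_abs (u.arg * α), abs_mul, abs_of_nonneg hα, mul_comm]
  refine Real.cos_le_cos_of_nonneg_of_le_pi (by positivity) ?_ (by gcongr)
  nlinarith [Real.pi_pos]

lemma le_norm_one_sub_mul_bromwichLine_cpow {α κ : ℝ} (hα : 0 ≤ α) (hα1 : α ≤ 1) (hκ : 0 ≤ κ)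
    (hκα : κ < Real.cos (α * (Real.pi / 2))) {z : ℂ} (hz : z.re < κ * ‖z‖) (ξ : ℝ) :
    (Real.cos (α * (Real.pi / 2)) - κ) / 4 * (1 + ‖z‖ * ‖bromwichLine ξ‖ ^ (-α)) ≤
      ‖1 - z * bromwichLine ξ ^ (-α : ℂ)‖ := by
  have h := mul_norm_add_norm_le_norm_sub hκ hκα (Real.cos_le_one _)
    (cos_mul_norm_le_re_cpow hα hα1 (u := bromwichLine ξ) (by simp [bromwichLine_re])) hz
  have hu : 0 < ‖bromwichLine ξ‖ := norm_pos_iff.2 (bromwichLine_ne_zero ξ)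
  have hwv : bromwichLine ξ ^ (α : ℂ) * bromwichLine ξ ^ (-α : ℂ) = 1 := by
    rw [← Complex.cpow_add _ _ (bromwichLine_ne_zero ξ)]
    simp
  have hwv' : ‖bromwichLine ξ‖ ^ α * ‖bromwichLine ξ‖ ^ (-α) = 1 := by
    rw [← Real.rpow_add hu]
    simp
  have heq : 1 - z * bromwichLine ξ ^ (-α : ℂ) =
      (bromwichLine ξ ^ (α : ℂ) - z) * bromwichLine ξ ^ (-α : ℂ) := by
    rw [sub_mul, hwv]
  rw [heq, norm_mul, norm_bromwichLine_cpow]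
  rw [norm_cpow_real] at h
  calc _ = (Real.cos (α * (Real.pi / 2)) - κ) / 4 * (‖bromwichLine ξ‖ ^ α + ‖z‖) *
        ‖bromwichLine ξ‖ ^ (-α) := by rw [mul_assoc, add_mul, hwv']
    _ ≤ _ := by gcongr

lemma differentiableOn_integral_bromwichKernel {α β κ : ℝ} (hα : 0 ≤ α) (hα1 : α ≤ 1) (hβ : 1 < β)
    (hκ : 0 ≤ κ) (hκα : κ < Real.cos (α * (Real.pi / 2))) :
    DifferentiableOn ℂ (fun z => ∫ ξ, bromwichKernel α β z ξ) {z : ℂ | z.re < κ * ‖z‖} := by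
  set c : ℝ := (Real.cos (α * (Real.pi / 2)) - κ) / 4 with hc
  have hc0 : 0 < c := by
    rw [hc]
    linarith
  have hlow : ∀ z : ℂ, z.re < κ * ‖z‖ → ∀ ξ, c ≤ ‖1 - z * bromwichLine ξ ^ (-α : ℂ)‖ := by
    intro z hz ξ
    refine le_trans ?_ (le_norm_one_sub_mul_bromwichLine_cpow hα hα1 hκ hκα hz ξ)
    exact le_mul_of_one_le_right hc0.le (le_add_of_nonneg_right (by positivity))
  have hopen : IsOpen {z : ℂ | z.re < κ * ‖z‖} :=
    isOpen_lt Complex.continuous_re (by fun_prop)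
  have hdom := integrable_norm_bromwichLine_rpow hβ
  intro z hz
  refine (hasDerivAt_integral_of_dominated_loc_of_deriv_le
    (F' := fun w ξ => cexp (bromwichLine ξ) * bromwichLine ξ ^ (-β : ℂ) *
      (bromwichLine ξ ^ (-α : ℂ) / (1 - w * bromwichLine ξ ^ (-α : ℂ)) ^ 2))
    (bound := fun ξ => Real.exp 1 * (c ^ 2)⁻¹ * ‖bromwichLine ξ‖ ^ (-β))
    (hopen.mem_nhds hz)
    (Filter.Eventually.of_forall fun w => (measurable_bromwichKernel α β w).aestronglyMeasurable)
    ?_ ?_ ?_ (hdom.const_mul _) ?_).2.differentiableAt.differentiableWithinAt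
  · refine (hdom.const_mul (Real.exp 1 * c⁻¹)).mono'
      (measurable_bromwichKernel α β z).aestronglyMeasurable
      (Filter.Eventually.of_forall fun ξ => ?_)
    rw [bromwichKernel, norm_div, norm_mul, norm_cexp_bromwichLine, norm_bromwichLine_cpow,
      div_eq_mul_inv, mul_right_comm]
    gcongr
    exact hlow z hz ξ
  · refine Measurable.aestronglyMeasurable ?_
    have h0 := continuous_bromwichLine.cexp.measurable
    have h1 := (continuous_bromwichLine_cpow (-α)).measurable
    have h2 := (continuous_bromwichLine_cpow (-β)).measurable
    fun_prop
  · refine Filter.Eventually.of_forall fun ξ w hw => ?_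
    rw [norm_mul, norm_mul, norm_cexp_bromwichLine, norm_bromwichLine_cpow, norm_div, norm_pow,
      mul_right_comm, div_eq_mul_inv]
    gcongr
    refine (mul_le_of_le_one_left (by positivity) (norm_bromwichLine_cpow_le_one hα ξ)).trans ?_
    gcongr
    exact hlow w hw ξ
  · refine Filter.Eventually.of_forall fun ξ w hw => ?_
    have hne : 1 - w * bromwichLine ξ ^ (-α : ℂ) ≠ 0 :=
      norm_pos_iff.1 (hc0.trans_le (hlow w hw ξ))
    have h := ((((hasDerivAt_id w).mul_const (bromwichLine ξ ^ (-α : ℂ))).const_sub 1).inv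
      hne).const_mul (cexp (bromwichLine ξ) * bromwichLine ξ ^ (-β : ℂ))
    simpa [bromwichKernel, div_eq_mul_inv] using h

lemma mittagLeffler_eq_integral {α β κ : ℝ} (hα : 0 < α) (hα1 : α ≤ 1) (hβ : 1 < β)
    (hκ : 0 ≤ κ) (hκα : κ < Real.cos (α * (Real.pi / 2))) {z : ℂ} (hz : z.re < κ * ‖z‖) :
    mittagLeffler α β z = ∫ ξ, bromwichKernel α β z ξ := by
  have hopen : IsOpen {z : ℂ | z.re < κ * ‖z‖} :=
    isOpen_lt Complex.continuous_re (by fun_prop)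
  have hmem : (-(1 / 2) : ℂ) ∈ {z : ℂ | z.re < κ * ‖z‖} := by
    have : (0 : ℝ) ≤ κ * 2⁻¹ := by positivity
    norm_num
    linarith
  refine AnalyticOnNhd.eqOn_of_preconnected_of_eventuallyEq
    ((differentiable_mittagLeffler hα (by linarith)).differentiableOn.analyticOnNhd hopen)
    ((differentiableOn_integral_bromwichKernel hα.le hα1 hβ hκ hκα).analyticOnNhd hopen)
    (isPreconnected_re_lt hκ (hκα.le.trans (Real.cos_le_one _))) hmem ?_ hz
  filter_upwards [Metric.isOpen_ball.mem_nhds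
    (show (-(1 / 2) : ℂ) ∈ Metric.ball (0 : ℂ) 1 by norm_num)] with w hw
  exact mittagLeffler_eq_integral_of_norm_lt_one hα hβ (mem_ball_zero_iff.1 hw)

/-- `E_{α,β}(z) = O(1 / (1 + |z|))` on some sector slightly larger than the left half-plane. -/
def DecaysOnSector (α β : ℝ) : Prop :=
  ∃ κ > (0 : ℝ), ∃ C > (0 : ℝ), κ < 1 ∧
    ∀ z : ℂ, z.re < κ * ‖z‖ → ‖mittagLeffler α β z‖ ≤ C / (1 + ‖z‖)

lemma decaysOnSector_of_one_add_lt {α β : ℝ} (hα : 0 < α) (hα1 : α < 1) (hβ : 1 + α < β) :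
    DecaysOnSector α β := by
  set κ₁ := Real.cos (α * (Real.pi / 2)) with hκ₁
  have hκ₁0 : 0 < κ₁ := Real.cos_pos_of_mem_Ioo
    ⟨by nlinarith [Real.pi_pos], by nlinarith [Real.pi_pos]⟩
  have hκ₁1 : κ₁ ≤ 1 := Real.cos_le_one _
  set c : ℝ := (κ₁ - κ₁ / 2) / 4 with hc
  have hc0 : 0 < c := by
    rw [hc]
    linarith
  set J : ℝ := ∫ ξ, ‖bromwichLine ξ‖ ^ (-(β - α)) with hJ
  have hJ0 : 0 ≤ J := integral_nonneg fun ξ => by positivity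
  have hdom := integrable_norm_bromwichLine_rpow (r := β - α) (by linarith)
  refine ⟨κ₁ / 2, by linarith, Real.exp 1 * c⁻¹ * J + 1, by positivity, by linarith,
    fun z hz => ?_⟩
  rw [mittagLeffler_eq_integral hα hα1.le (by linarith) (by linarith) (by linarith) hz]
  have hb : ∀ ξ, ‖bromwichKernel α β z ξ‖ ≤
      Real.exp 1 * c⁻¹ / (1 + ‖z‖) * ‖bromwichLine ξ‖ ^ (-(β - α)) := fun ξ => by
    have h := le_norm_one_sub_mul_bromwichLine_cpow hα.le hα1.le (by linarith) (by linarith) hz ξ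
    have hu : 0 < ‖bromwichLine ξ‖ := norm_pos_iff.2 (bromwichLine_ne_zero ξ)
    have hv : ‖bromwichLine ξ‖ ^ (-α) ≤ 1 := by
      rw [← norm_bromwichLine_cpow]
      exact norm_bromwichLine_cpow_le_one hα.le ξ
    have hv0 : 0 < ‖bromwichLine ξ‖ ^ (-α) := by positivity
    have h' : c * ((1 + ‖z‖) * ‖bromwichLine ξ‖ ^ (-α)) ≤
        ‖1 - z * bromwichLine ξ ^ (-α : ℂ)‖ := by
      refine le_trans ?_ h
      rw [← hκ₁, ← hc, add_mul, one_mul]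
      gcongr
    have hsplit : ‖bromwichLine ξ‖ ^ (-β) =
        ‖bromwichLine ξ‖ ^ (-(β - α)) * ‖bromwichLine ξ‖ ^ (-α) := by
      rw [← Real.rpow_add hu]
      ring_nf
    rw [bromwichKernel, norm_div, norm_mul, norm_cexp_bromwichLine, norm_bromwichLine_cpow]
    calc _ ≤ Real.exp 1 * ‖bromwichLine ξ‖ ^ (-β) /
          (c * ((1 + ‖z‖) * ‖bromwichLine ξ‖ ^ (-α))) := by gcongr
      _ = _ := by
        rw [hsplit]
        field_simp
  refine (norm_integral_le_of_norm_le (hdom.const_mul _) (Filter.Eventually.of_forall hb)).trans ?_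
  rw [integral_const_mul, ← hJ, div_mul_eq_mul_div]
  gcongr
  linarith

lemma DecaysOnSector.of_add_one {α β : ℝ} (hα : 0 < α) (hβ : 0 < β)
    (h : DecaysOnSector α (β + 1)) : DecaysOnSector α β := by
  obtain ⟨κ, hκ, C, hC, hκ1, hE⟩ := h
  set ε := κ / 4 with hε
  refine ⟨κ / 2, by linarith, α * (2 * C / ε) + β * C, by positivity, by linarith,
    fun z hz => ?_⟩
  have hz0 : 0 < ‖z‖ := by
    rw [norm_pos_iff]
    rintro rfl
    simp at hz
  have hsphere : ∀ w ∈ Metric.sphere z (ε * ‖z‖),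
      ‖mittagLeffler α (β + 1) w‖ ≤ 2 * C / (1 + ‖z‖) := fun w hw => by
    have hwz : ‖w - z‖ = ε * ‖z‖ := mem_sphere_iff_norm.1 hw
    have h1 : ‖z‖ - ‖w‖ ≤ ‖w - z‖ := by rw [norm_sub_rev]; exact norm_sub_norm_le z w
    have h2 : w.re - z.re ≤ ‖w - z‖ := by simpa using Complex.re_le_norm (w - z)
    have h3 : 3 / 4 * ‖z‖ ≤ ‖w‖ := by nlinarith
    refine (hE w ?_).trans ?_
    · have h4 := mul_le_mul_of_nonneg_left h3 hκ.le
      rw [hwz, hε] at h2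
      linarith
    · rw [div_le_div_iff₀ (by positivity) (by positivity), mul_comm 2 C, mul_assoc]
      gcongr
      linarith
  have hderiv := Complex.norm_deriv_le_of_forall_mem_sphere_norm_le (mul_pos (by positivity) hz0)
    (differentiable_mittagLeffler hα (by linarith)).diffContOnCl hsphere
  have hκz : z.re < κ * ‖z‖ := by nlinarith
  rw [mittagLeffler_eq_deriv hα hβ]
  calc _ ≤ α * ‖z‖ * ‖deriv (mittagLeffler α (β + 1)) z‖ + β * ‖mittagLeffler α (β + 1) z‖ := by
        refine (norm_add_le _ _).trans_eq ?_
        simp [abs_of_pos hα, abs_of_pos hβ]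
    _ ≤ α * ‖z‖ * (2 * C / (1 + ‖z‖) / (ε * ‖z‖)) + β * (C / (1 + ‖z‖)) := by
        gcongr
        exact hE z hκz
    _ = _ := by field_simp

theorem stmt_7 (α β : ℝ) (hα0 : 0 < α) (hα1 : α < 1) (hβ : 0 < β) :
    ∃ C > (0 : ℝ), ∀ lam : ℝ, 0 < lam → ∀ t : ℝ,
      ‖mittagLeffler α β (Complex.I * ((lam * t : ℝ) : ℂ))‖ ≤ C / (1 + lam * |t|) := by
  obtain ⟨κ, hκ, C, hC, -, hE⟩ : DecaysOnSector α β :=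
    .of_add_one hα0 hβ (.of_add_one hα0 (by linarith)
      (decaysOnSector_of_one_add_lt hα0 hα1 (by linarith)))
  refine ⟨C + ‖mittagLeffler α β 0‖, by positivity, fun lam hlam t => ?_⟩
  rcases eq_or_ne t 0 with rfl | ht
  · simpa using hC.le
  · have hnorm : ‖Complex.I * ((lam * t : ℝ) : ℂ)‖ = lam * |t| := by
      simp [abs_of_pos hlam]
    have h := hE (Complex.I * ((lam * t : ℝ) : ℂ)) (by
      rw [hnorm]
      simp only [Complex.I_mul_re, Complex.ofReal_im, neg_zero]
      positivity)
    rw [hnorm] at h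
    refine h.trans ?_
    gcongr
    exact le_add_of_nonneg_right (norm_nonneg _)
end

section
/- Every real homogeneous polynomial of degree three in two variables can be reduced by an invertible real linear change of variables to exactly one of the following normal forms: (1) x₁² x₂, (2) x₁² x₂ + x₂³ or x₁² x₂ - x₂³, (3) x₁³, (4) 0. That is, for every homogeneous cubic P(x₁,x₂) = a x₁³ + b x₁² x₂ + c x₁ x₂² + d x₂³ with real coefficients there exists an invertible 2×2 real matrix L such that P ∘ L equals one of these four forms. -/
/-- A general homogeneous cubic form in two real variables. -/
def cubicForm (a b c d : ℝ) (x y : ℝ) : ℝ :=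
  a * x ^ 3 + b * x ^ 2 * y + c * x * y ^ 2 + d * y ^ 3

/-- A function of two real variables becomes one of the normal forms of a binary cubic after an
invertible linear change of variables. -/
def HasCubicNormalForm (P : ℝ → ℝ → ℝ) : Prop :=
  ∃ L : Matrix (Fin 2) (Fin 2) ℝ, IsUnit L.det ∧
    ((∀ x y : ℝ, P (L 0 0 * x + L 0 1 * y) (L 1 0 * x + L 1 1 * y) = x ^ 2 * y) ∨
     (∀ x y : ℝ, P (L 0 0 * x + L 0 1 * y) (L 1 0 * x + L 1 1 * y) = x ^ 2 * y + y ^ 3) ∨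
     (∀ x y : ℝ, P (L 0 0 * x + L 0 1 * y) (L 1 0 * x + L 1 1 * y) = x ^ 2 * y - y ^ 3) ∨
     (∀ x y : ℝ, P (L 0 0 * x + L 0 1 * y) (L 1 0 * x + L 1 1 * y) = x ^ 3) ∨
     (∀ x y : ℝ, P (L 0 0 * x + L 0 1 * y) (L 1 0 * x + L 1 1 * y) = 0))

namespace HasCubicNormalForm

theorem of_eq {P : ℝ → ℝ → ℝ}
    (h : P = (fun x y => x ^ 2 * y) ∨ P = (fun x y => x ^ 2 * y + y ^ 3) ∨
      P = (fun x y => x ^ 2 * y - y ^ 3) ∨ P = (fun x _ => x ^ 3) ∨ P = fun _ _ => 0) :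
    HasCubicNormalForm P := by
  refine ⟨1, by simp, ?_⟩
  rcases h with rfl | rfl | rfl | rfl | rfl <;> simp

theorem of_comp {P : ℝ → ℝ → ℝ} (p q r s : ℝ) (hdet : p * s - q * r ≠ 0)
    (h : HasCubicNormalForm fun x y => P (p * x + q * y) (r * x + s * y)) :
    HasCubicNormalForm P := by
  obtain ⟨L, hL, h⟩ := h
  refine ⟨!![p, q; r, s] * L, ?_, ?_⟩
  · rw [Matrix.det_mul, Matrix.det_fin_two_of]
    exact (isUnit_iff_ne_zero.mpr hdet).mul hL
  · have key (x y : ℝ) :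
        P ((!![p, q; r, s] * L) 0 0 * x + (!![p, q; r, s] * L) 0 1 * y)
            ((!![p, q; r, s] * L) 1 0 * x + (!![p, q; r, s] * L) 1 1 * y) =
          P (p * (L 0 0 * x + L 0 1 * y) + q * (L 1 0 * x + L 1 1 * y))
            (r * (L 0 0 * x + L 0 1 * y) + s * (L 1 0 * x + L 1 1 * y)) := by
      congr 1 <;> simp [Matrix.mul_apply, Fin.sum_univ_two] <;> ring
    simpa only [key] using h

end HasCubicNormalForm

theorem exists_monic_cubic_root (b c d : ℝ) : ∃ t : ℝ, t ^ 3 + b * t ^ 2 + c * t + d = 0 := by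
  set T := 1 + |b| + |c| + |d| with hT
  have hb := abs_nonneg b
  have hc := abs_nonneg c
  have hd := abs_nonneg d
  have hT1 : 1 ≤ T := by linarith
  have hTsq : T ≤ T ^ 2 := by nlinarith
  have hbT : |b * T ^ 2| = |b| * T ^ 2 := by rw [abs_mul, abs_of_nonneg (sq_nonneg T)]
  have hcT : |c * T| ≤ |c| * T ^ 2 := by
    rw [abs_mul, abs_of_nonneg (by linarith : 0 ≤ T)]
    gcongr
  have hdT : |d| ≤ |d| * T ^ 2 := le_mul_of_one_le_right hd (by linarith)
  have hcube : T ^ 3 = T ^ 2 + |b| * T ^ 2 + |c| * T ^ 2 + |d| * T ^ 2 := by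
    rw [pow_succ' T 2]
    nth_rewrite 1 [hT]
    ring
  have hbT' := abs_le.mp hbT.le
  have hcT' := abs_le.mp hcT
  have hdT' := abs_le.mp hdT
  obtain ⟨t, -, ht⟩ := intermediate_value_Icc (by linarith : -T ≤ T)
    (f := fun t : ℝ => t ^ 3 + b * t ^ 2 + c * t + d) (by fun_prop)
    (show (0 : ℝ) ∈ Set.Icc _ _ from ⟨by nlinarith, by nlinarith⟩)
  exact ⟨t, ht⟩

theorem exists_cube_eq (s : ℝ) : ∃ t : ℝ, t ^ 3 = s := by
  obtain ⟨t, ht⟩ := exists_monic_cubic_root 0 0 (-s)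
  exact ⟨t, by linarith⟩

/-- The diagonal forms `b x² y + e y³` with `b ≠ 0`. -/
theorem hasCubicNormalForm_diagonal {b : ℝ} (hb : b ≠ 0) (e : ℝ) :
    HasCubicNormalForm (cubicForm 0 b 0 e) := by
  rcases eq_or_ne e 0 with rfl | he
  · refine .of_comp 1 0 0 b⁻¹ (by simpa using hb) (.of_eq (.inl ?_))
    ext x y
    simp only [cubicForm]
    field_simp
    ring
  obtain ⟨q, hq⟩ := exists_cube_eq e⁻¹
  have heq : e * q ^ 3 = 1 := by rw [hq, mul_inv_cancel₀ he]
  have hq0 : q ≠ 0 := by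
    rintro rfl
    simp at heq
  have scale {u : ℝ} (hu : 0 < b * u) :
      √(b * u)⁻¹ * u - 0 * 0 ≠ 0 ∧ b * u * √(b * u)⁻¹ ^ 2 = 1 := by
    rw [Real.sq_sqrt (inv_nonneg.mpr hu.le), mul_inv_cancel₀ hu.ne']
    refine ⟨?_, rfl⟩
    rw [mul_zero, sub_zero]
    exact mul_ne_zero (Real.sqrt_pos.mpr (inv_pos.mpr hu)).ne' (right_ne_zero_of_mul hu.ne')
  rcases lt_or_gt_of_ne (mul_ne_zero hb hq0) with hneg | hpos
  · obtain ⟨hdet, hp⟩ := scale (u := -q) (by linarith)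
    refine .of_comp _ 0 0 (-q) hdet (.of_eq (.inr (.inr (.inl ?_))))
    ext x y
    simp only [cubicForm]
    linear_combination x ^ 2 * y * hp - y ^ 3 * heq
  · obtain ⟨hdet, hp⟩ := scale hpos
    refine .of_comp _ 0 0 q hdet (.of_eq (.inr (.inl ?_)))
    ext x y
    simp only [cubicForm]
    linear_combination x ^ 2 * y * hp + y ^ 3 * heq

/-- The cubic forms divisible by `y`. -/
theorem hasCubicNormalForm_of_leading_zero (b c d : ℝ) :
    HasCubicNormalForm (cubicForm 0 b c d) := by
  rcases ne_or_eq b 0 with hb | rfl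
  · refine .of_comp 1 (-(c / (2 * b))) 0 1 (by simp) ?_
    convert hasCubicNormalForm_diagonal hb (d - c ^ 2 / (4 * b)) using 1
    ext x y
    simp only [cubicForm]
    field_simp
    ring
  rcases ne_or_eq c 0 with hc | rfl
  · refine .of_comp (-d / c) c⁻¹ 1 0 (by simpa using hc) (.of_eq (.inl ?_))
    ext x y
    simp only [cubicForm]
    field_simp
    ring
  rcases ne_or_eq d 0 with hd | rfl
  · obtain ⟨q, hq⟩ := exists_cube_eq d⁻¹
    have hdq : d * q ^ 3 = 1 := by rw [hq, mul_inv_cancel₀ hd]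
    have hq0 : q ≠ 0 := by
      rintro rfl
      simp at hdq
    refine .of_comp 0 1 q 0 (by simpa using hq0) (.of_eq (.inr (.inr (.inr (.inl ?_)))))
    ext x y
    simp only [cubicForm]
    linear_combination x ^ 3 * hdq
  · refine .of_eq (.inr (.inr (.inr (.inr ?_))))
    ext x y
    simp [cubicForm]

theorem hasCubicNormalForm_cubicForm (a b c d : ℝ) : HasCubicNormalForm (cubicForm a b c d) := by
  rcases eq_or_ne a 0 with rfl | ha
  · exact hasCubicNormalForm_of_leading_zero b c d
  obtain ⟨t, ht⟩ := exists_monic_cubic_root (b / a) (c / a) (d / a)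
  have hroot : a * t ^ 3 + b * t ^ 2 + c * t + d = 0 := by
    field_simp at ht
    linarith
  refine .of_comp t 1 1 0 (by simp) ?_
  convert hasCubicNormalForm_of_leading_zero (3 * a * t ^ 2 + 2 * b * t + c) (3 * a * t + b) a
    using 1
  ext x y
  simp only [cubicForm]
  linear_combination x ^ 3 * hroot

theorem stmt_8 (a b c d : ℝ) :
    ∃ L : Matrix (Fin 2) (Fin 2) ℝ, IsUnit L.det ∧
      ((∀ x y : ℝ, cubicForm a b c d (L 0 0 * x + L 0 1 * y) (L 1 0 * x + L 1 1 * y)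
          = x ^ 2 * y) ∨
       (∀ x y : ℝ, cubicForm a b c d (L 0 0 * x + L 0 1 * y) (L 1 0 * x + L 1 1 * y)
          = x ^ 2 * y + y ^ 3) ∨
       (∀ x y : ℝ, cubicForm a b c d (L 0 0 * x + L 0 1 * y) (L 1 0 * x + L 1 1 * y)
          = x ^ 2 * y - y ^ 3) ∨
       (∀ x y : ℝ, cubicForm a b c d (L 0 0 * x + L 0 1 * y) (L 1 0 * x + L 1 1 * y)
          = x ^ 3) ∨
       (∀ x y : ℝ, cubicForm a b c d (L 0 0 * x + L 0 1 * y) (L 1 0 * x + L 1 1 * y)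
          = 0)) :=
  hasCubicNormalForm_cubicForm a b c d
end

section
/- Let q > 1. Then there exists a constant C_q > 0, depending only on q, such that for all λ ≥ 1, ∫₀¹ (1 - (1 + λ x²)^{1-q}) / ((q-1) λ x²) dx ≤ C_q / √λ. -/
open MeasureTheory Set

lemma one_sub_rpow_div_nonneg {q y : ℝ} (hq : 1 < q) (hy : 0 < y) :
    0 ≤ (1 - (1 + y) ^ (1 - q)) / ((q - 1) * y) := by
  have h : (1 + y) ^ (1 - q) ≤ 1 :=
    Real.rpow_le_one_of_one_le_of_nonpos (by linarith) (by linarith)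
  have hq' : 0 < q - 1 := by linarith
  exact div_nonneg (by linarith) (by positivity)

lemma one_sub_rpow_div_le {q y : ℝ} (hq : 1 < q) (hy : 0 < y) :
    (1 - (1 + y) ^ (1 - q)) / ((q - 1) * y) ≤ q / (q - 1) * (1 + y)⁻¹ := by
  have hq' : 0 < q - 1 := by linarith
  have hy' : 0 < 1 + y := by linarith
  have bernoulli : 1 - (1 + y) ^ (1 - q) ≤ (q - 1) * y := by
    have hexp := Real.add_one_le_exp (Real.log (1 + y) * (1 - q))
    have hlog := Real.log_le_sub_one_of_pos hy'
    rw [Real.rpow_def_of_pos hy']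
    nlinarith
  have hpos : 0 < (1 + y) ^ (1 - q) := Real.rpow_pos_of_pos hy' _
  rw [← div_eq_mul_inv, div_div, div_le_div_iff₀ (by positivity) (by positivity)]
  have key : (1 - (1 + y) ^ (1 - q)) * (1 + y) ≤ q * y := by nlinarith
  nlinarith

lemma integrable_inv_one_add_mul_sq {a : ℝ} (ha : 0 < a) :
    Integrable fun x : ℝ => (1 + a * x ^ 2)⁻¹ := by
  have h := integrable_inv_one_add_sq.comp_mul_left' (Real.sqrt_pos.2 ha).ne'
  simpa only [mul_pow, Real.sq_sqrt ha.le] using h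

lemma integral_inv_one_add_mul_sq {a : ℝ} (ha : 0 < a) :
    ∫ x : ℝ, (1 + a * x ^ 2)⁻¹ = Real.pi / Real.sqrt a := by
  have h := Measure.integral_comp_mul_left (fun x : ℝ => (1 + x ^ 2)⁻¹) (Real.sqrt a)
  simp only [mul_pow, Real.sq_sqrt ha.le, integral_univ_inv_one_add_sq, smul_eq_mul] at h
  rw [h, abs_of_nonneg (by positivity), div_eq_inv_mul]

theorem stmt_9 (q : ℝ) (hq : 1 < q) :
    ∃ C > (0 : ℝ), ∀ lam : ℝ, 1 ≤ lam →
      ∫ x in Ioo (0 : ℝ) 1,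
          (1 - (1 + lam * x ^ 2) ^ (1 - q)) / ((q - 1) * lam * x ^ 2) ≤
        C / Real.sqrt lam := by
  have hq' : 0 < q - 1 := by linarith
  have hK : 0 < q / (q - 1) := div_pos (by linarith) hq'
  refine ⟨q / (q - 1) * Real.pi, mul_pos hK Real.pi_pos, fun lam hlam => ?_⟩
  have hl : 0 < lam := by linarith
  have hint := (integrable_inv_one_add_mul_sq hl).const_mul (q / (q - 1))
  calc ∫ x in Ioo (0 : ℝ) 1, (1 - (1 + lam * x ^ 2) ^ (1 - q)) / ((q - 1) * lam * x ^ 2)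
      ≤ ∫ x in Ioo (0 : ℝ) 1, q / (q - 1) * (1 + lam * x ^ 2)⁻¹ := by
        refine integral_mono_of_nonneg ?_ hint.integrableOn ?_ <;>
          filter_upwards [ae_restrict_mem measurableSet_Ioo] with x hx <;>
          have hy : 0 < lam * x ^ 2 := mul_pos hl (pow_pos hx.1 2) <;>
          rw [mul_assoc (q - 1)]
        · exact one_sub_rpow_div_nonneg hq hy
        · exact one_sub_rpow_div_le hq hy
    _ ≤ ∫ x : ℝ, q / (q - 1) * (1 + lam * x ^ 2)⁻¹ :=
        setIntegral_le_integral hint (Filter.Eventually.of_forall fun x => by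
          dsimp only [Pi.zero_apply]; positivity)
    _ = q / (q - 1) * Real.pi / Real.sqrt lam := by
        rw [integral_const_mul, integral_inv_one_add_mul_sq hl, mul_div_assoc]
end
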